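/- arXiv:1101.4715 — 5 statements merged into one kernel-verified Lean document; each statement's English description precedes it below -/
import Mathlib

section
/- Let A be a subset of a finite abelian group G such that 0 ∉ A and |A| ≥ 14. Then at least one of the following holds: (i) |Σ°(A)| ≥ min(|G| − 3, 3|A| − 3); (ii) there is a proper subgroup H of G such that |A ∩ H| ≥ |A| − 1. -/
open Finset

/-- The set of all nonempty subset sums of a finite set `A`. -/
def nss {G : Type*} [AddCommGroup G] [DecidableEq G] (A : Finset G) : Finset G :=
  (A.powerset.erase ∅).image fun B => B.sum id

open scoped Pointwise

/-- The number of `b ∈ B` that leave `B` under translation by `x`. -/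
def escapeCard {G : Type*} [AddCommGroup G] [DecidableEq G] (B : Finset G) (x : G) : ℕ :=
  #{b ∈ B | b + x ∉ B}

section escapeCard

variable {G : Type*} [AddCommGroup G] [DecidableEq G] (B : Finset G)

lemma escapeCard_zero : escapeCard B 0 = 0 := by
  simp [escapeCard]

lemma escapeCard_add_le (x y : G) :
    escapeCard B (x + y) ≤ escapeCard B x + escapeCard B y := by
  have hsub : {b ∈ B | b + (x + y) ∉ B} ⊆
      {b ∈ B | b + x ∉ B} ∪ ({b ∈ B | b + y ∉ B}).image (· - x) := by
    intro b hb
    simp only [mem_union, mem_filter, mem_image] at hb ⊢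
    by_cases hx : b + x ∈ B
    · exact Or.inr ⟨b + x, ⟨hx, by rw [add_assoc]; exact hb.2⟩, by abel⟩
    · exact Or.inl ⟨hb.1, hx⟩
  exact (card_le_card hsub).trans ((card_union_le _ _).trans
    (Nat.add_le_add_left card_image_le _))

lemma escapeCard_add_card_filter (x : G) :
    escapeCard B x + #{b ∈ B | b + x ∈ B} = #B := by
  rw [add_comm]
  exact card_filter_add_card_filter_not (s := B) (fun b => b + x ∈ B)

lemma escapeCard_neg (x : G) : escapeCard B (-x) = escapeCard B x := by
  have h : #{b ∈ B | b + -x ∈ B} = #{b ∈ B | b + x ∈ B} := by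
    refine card_bij (fun b _ => b + -x) ?_ (fun a _ b _ hab => add_right_cancel hab) ?_
    · intro b hb
      simp only [mem_filter] at hb ⊢
      exact ⟨hb.2, by simpa using hb.1⟩
    · intro b hb
      simp only [mem_filter] at hb ⊢
      exact ⟨b + x, ⟨hb.2, by simpa using hb.1⟩, by simp⟩
  have h₁ := escapeCard_add_card_filter B x
  have h₂ := escapeCard_add_card_filter B (-x)
  omega

lemma escapeCard_compl [Fintype G] (x : G) : escapeCard Bᶜ x = escapeCard B x := by
  rw [← escapeCard_neg B]
  refine card_bij (fun b _ => b + x) ?_ (fun a _ b _ hab => add_right_cancel hab) ?_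
  · intro b hb
    simpa [and_comm] using hb
  · intro b hb
    simp only [mem_filter, mem_compl] at hb ⊢
    exact ⟨b + -x, ⟨hb.2, by simpa using hb.1⟩, by simp⟩

lemma card_mul_sub_le_sum_escapeCard (Y : Finset G) :
    #B * (#Y - #B) ≤ ∑ x ∈ Y, escapeCard B x := by
  have h₁ : ∑ x ∈ Y, #{b ∈ B | b + x ∈ B} ≤ #B * #B := by
    rw [← card_product, ← card_sigma]
    refine card_le_card_of_injOn (fun p => (p.2, p.2 + p.1)) ?_ ?_
    · rintro ⟨x, b⟩ hp
      simp only [coe_sigma, Set.mem_sigma_iff, mem_coe, mem_filter] at hp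
      simpa using hp.2
    · rintro ⟨x, b⟩ - ⟨y, c⟩ - h
      simp only [Prod.mk.injEq] at h
      obtain ⟨rfl, h⟩ := h
      rw [add_left_cancel h]
  have h₂ : ∑ x ∈ Y, escapeCard B x + ∑ x ∈ Y, #{b ∈ B | b + x ∈ B} = #Y * #B := by
    rw [← sum_add_distrib]
    simp [escapeCard_add_card_filter]
  rw [Nat.mul_sub, mul_comm #B #Y]
  omega

end escapeCard

section subsetSum

variable {G : Type*} [AddCommGroup G] [DecidableEq G]

lemma subsetSum_insert_eq_union {A : Finset G} {x : G} (hx : x ∉ A) :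
    (insert x A).subsetSum = A.subsetSum ∪ A.subsetSum.image (· + x) := by
  ext g
  simp only [subsetSum, powerset_insert, image_union, mem_union, image_image, mem_image,
    Function.comp_apply]
  refine or_congr_right (exists_congr fun B => and_congr_right fun hB => ?_)
  rw [sum_insert (fun h => hx (mem_powerset.1 hB h)), id, add_comm]

lemma card_lt_card_subsetSum {A : Finset G} (h0 : (0 : G) ∉ A) : #A < #A.subsetSum := by
  have h := card_le_card (insert_subset (zero_mem_subsetSum (A := A)) subset_subsetSum)
  rwa [card_insert_of_notMem h0] at h

lemma mem_closure_of_mem_subsetSum {A : Finset G} {g : G} (hg : g ∈ A.subsetSum) :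
    g ∈ AddSubgroup.closure (A : Set G) := by
  obtain ⟨B, hB, rfl⟩ := mem_subsetSum_iff.1 hg
  exact sum_mem fun b hb => AddSubgroup.subset_closure (hB hb)

lemma card_subsetSum_erase_add_le {A : Finset G} {x : G} (hx : x ∈ A) :
    #(A.erase x).subsetSum + escapeCard A.subsetSum x ≤ #A.subsetSum := by
  obtain ⟨C, hC, rfl⟩ : ∃ C : Finset G, x ∉ C ∧ insert x C = A :=
    ⟨A.erase x, by simp, insert_erase hx⟩
  rw [erase_insert hC, subsetSum_insert_eq_union hC]
  set B := C.subsetSum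
  have h : (({b ∈ B ∪ B.image (· + x) | b + x ∉ B ∪ B.image (· + x)}).image (· + x)) ⊆
      ((B ∪ B.image (· + x)) \ B).image (· + x) := by
    intro g hg
    simp only [mem_image, mem_filter, mem_union, mem_sdiff] at hg ⊢
    obtain ⟨b, ⟨hb, hb'⟩, rfl⟩ := hg
    push Not at hb'
    exact ⟨b, ⟨hb, fun h => hb'.2 b h rfl⟩, rfl⟩
  have h' := card_le_card h
  rw [card_image_of_injective _ (add_left_injective x),
    card_image_of_injective _ (add_left_injective x),
    card_sdiff_of_subset subset_union_left] at h'
  have h'' := card_le_card (subset_union_left (s₁ := B) (s₂ := B.image (· + x)))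
  rw [escapeCard]
  omega

lemma subsetSum_map {H : Type*} [AddCommGroup H] [DecidableEq H] (f : H →+ G)
    (hf : Function.Injective f) (C : Finset H) :
    (C.map ⟨f, hf⟩).subsetSum = C.subsetSum.map ⟨f, hf⟩ := by
  ext g
  simp only [mem_subsetSum_iff, mem_map, Function.Embedding.coeFn_mk]
  constructor
  · rintro ⟨B, hB, rfl⟩
    obtain ⟨D, hD, rfl⟩ := subset_map_iff.1 hB
    exact ⟨_, ⟨D, hD, rfl⟩, by simp⟩
  · rintro ⟨_, ⟨D, hD, rfl⟩, rfl⟩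
    exact ⟨_, map_subset_map.2 hD, by simp⟩

end subsetSum

section growth

variable {G : Type*} [AddCommGroup G] [DecidableEq G] [Fintype G]

lemma compl_add_add_subset_compl {S : Finset G} (hneg : -S = S) (Y : Finset G) :
    (Y + S)ᶜ + S ⊆ Yᶜ := by
  intro g hg
  obtain ⟨z, hz, s, hs, rfl⟩ := mem_add.1 hg
  rw [mem_compl] at hz ⊢
  intro hy
  refine hz (mem_add.2 ⟨z + s, hy, -s, ?_, by abel⟩)
  rw [← hneg]
  exact neg_mem_neg hs

/-- A finite set `X` with nonfull `X + S` of least expansion, and smallest among those: it is a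
coset of a subgroup, expressed by closure under `x + y - z`. -/
lemma exists_atom {S : Finset G} (h0 : (0 : G) ∈ S) (hneg : -S = S) {Y : Finset G}
    (hY : Y.Nonempty) (hYS : Y + S ≠ univ) :
    ∃ X : Finset G, X.Nonempty ∧ X + S ≠ univ ∧
      (∀ Z : Finset G, Z.Nonempty → Z + S ≠ univ → #(X + S) + #Z ≤ #(Z + S) + #X) ∧
      ∀ x ∈ X, ∀ y ∈ X, ∀ z ∈ X, x + (y - z) ∈ X := by
  have hle : ∀ Z : Finset G, #Z ≤ #(Z + S) := fun Z => card_le_card (subset_add_left Z h0)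
  obtain ⟨W, hW, hWmin⟩ := exists_min_image
    ({Z | Z.Nonempty ∧ Z + S ≠ univ} : Finset (Finset G)) (fun Z => #(Z + S) - #Z)
    ⟨Y, by simp [hY, hYS]⟩
  obtain ⟨κ, hκ⟩ : ∃ κ, κ = #(W + S) - #W := ⟨_, rfl⟩
  obtain ⟨X, hX, hXmin⟩ := exists_min_image
    ({Z | Z.Nonempty ∧ Z + S ≠ univ ∧ #(Z + S) - #Z = κ} : Finset (Finset G)) card
    ⟨W, by simpa [hκ] using hW⟩
  simp only [mem_filter, mem_univ, true_and] at hW hX hWmin hXmin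
  obtain ⟨hXne, hXS, hXκ⟩ := hX
  have hmin : ∀ Z : Finset G, Z.Nonempty → Z + S ≠ univ → #Z + κ ≤ #(Z + S) := by
    intro Z hZ hZS
    have h₁ := hWmin Z ⟨hZ, hZS⟩
    have h₂ := hle Z
    omega
  have hXκ' : #(X + S) = #X + κ := by
    have := hle X
    omega
  refine ⟨X, hXne, hXS, fun Z hZ hZS => ?_, ?_⟩
  · have := hmin Z hZ hZS
    omega
  have hcompl : #X ≤ #(X + S)ᶜ := by
    have hne : ((X + S)ᶜ).Nonempty := by
      rwa [nonempty_iff_ne_empty, Ne, compl_eq_empty_iff]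
    have hsub := compl_add_add_subset_compl hneg X
    have hne' : (X + S)ᶜ + S ≠ univ := by
      intro h
      obtain ⟨x, hx⟩ := hXne
      have := hsub (h ▸ mem_univ x)
      exact (mem_compl.1 this) hx
    refine hXmin _ ⟨hne, hne', ?_⟩
    have h₁ := hmin _ hne hne'
    have h₂ := card_le_card hsub
    have h₃ := card_compl X
    have h₄ := card_compl (X + S)
    have h₅ := card_le_univ (X + S)
    omega
  intro x hx y hy z hz
  set X' := (y - z) +ᵥ X with hX'
  have hX'S : X' + S = (y - z) +ᵥ (X + S) := vadd_add_assoc _ _ _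
  have hI : (X ∩ X').Nonempty :=
    ⟨y, mem_inter.2 ⟨hy, mem_vadd_finset.2 ⟨z, hz, by simp⟩⟩⟩
  have hIS : (X ∩ X') + S ⊆ (X + S) ∩ (X' + S) := inter_add_subset
  have hIS' : (X ∩ X') + S ≠ univ := fun h =>
    hXS (eq_univ_of_forall fun g => (mem_inter.1 (hIS (h ▸ mem_univ g))).1)
  have hc₁ : #X' = #X := card_vadd_finset _ _
  have hc₂ : #(X' + S) = #(X + S) := by rw [hX'S, card_vadd_finset]
  have hu := card_union_add_card_inter X X'
  have huS := card_union_add_card_inter (X + S) (X' + S)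
  rw [← union_add] at huS
  have hi := hmin _ hI hIS'
  have hi' := card_le_card hIS
  have hIpos := hI.card_pos
  have hcu := card_compl (X + S)
  have hcu' := card_le_univ (X + S)
  have hU : (X ∪ X') + S ≠ univ := by
    intro h
    rw [h, card_univ] at huS
    omega
  have hu' := hmin _ (hXne.mono subset_union_left) hU
  have hX'le := hXmin _ ⟨hI, hIS', by omega⟩
  have hXX' : X ∩ X' = X := eq_of_subset_of_card_le inter_subset_left hX'le
  have hXX'' : X = X' := eq_of_subset_of_card_le (inter_eq_left.1 hXX') hc₁.le
  rw [hXX'']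
  exact mem_vadd_finset.2 ⟨x, hx, by simp [add_comm]⟩

lemma two_mul_card_add_card_le_of_add_ne_univ {S : Finset G} (h0 : (0 : G) ∈ S)
    (hneg : -S = S) (hS : AddSubgroup.closure (S : Set G) = ⊤) {Y : Finset G}
    (hY : Y.Nonempty) (hYS : Y + S ≠ univ) : 2 * #Y + #S ≤ 2 * #(Y + S) := by
  obtain ⟨X, ⟨x, hx⟩, hXS, hmin, hcoset⟩ := exists_atom h0 hneg hY hYS
  have hYmin := hmin Y hY hYS
  have hle : #S ≤ #(X + S) := card_le_card_add_left ⟨x, hx⟩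
  have hsub : X ⊆ X + S := subset_add_left X h0
  obtain ⟨s, hs, hsX⟩ : ∃ s ∈ S, x + s ∉ X := by
    by_contra! h
    refine hXS (eq_univ_of_forall fun g => hsub ?_)
    have hmem : ∀ a ∈ AddSubgroup.closure (S : Set G), x + a ∈ X := by
      intro a ha
      induction ha using AddSubgroup.closure_induction with
      | mem a ha => exact h a ha
      | zero => simpa using hx
      | add a b _ _ ha hb =>
        have := hcoset _ ha _ hb _ hx
        rwa [show x + a + (x + b - x) = x + (a + b) by abel] at this
      | neg a _ ha =>
        have := hcoset _ hx _ hx _ ha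
        rwa [show x + (x - (x + a)) = x + -a by abel] at this
    simpa using hmem (g - x) (hS ▸ AddSubgroup.mem_top _)
  have hdisj : Disjoint X (X.image (· + s)) := by
    rw [disjoint_left]
    intro y hy hy'
    obtain ⟨z, hz, rfl⟩ := mem_image.1 hy'
    have := hcoset _ hx _ hy _ hz
    exact hsX (by simpa using this)
  have hcard : #X + #X ≤ #(X + S) := by
    nth_rewrite 2 [← card_image_of_injective X (add_left_injective s)]
    rw [← card_union_of_disjoint hdisj]
    refine card_le_card (union_subset hsub fun y hy => ?_)
    obtain ⟨z, hz, rfl⟩ := mem_image.1 hy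
    exact add_mem_add hz hs
  omega

/-- A lower bound for the size of the `t`-th ball of a symmetric generating set of size `p`. -/
def ballBound (p : ℕ) : ℕ → ℕ
  | 0 => 1
  | t + 1 => p + t * ((p + 1) / 2)

lemma ballBound_le_card_nsmul {S : Finset G} (h0 : (0 : G) ∈ S) (hneg : -S = S)
    (hS : AddSubgroup.closure (S : Set G) = ⊤) {p : ℕ} (hp : p ≤ #S) (t : ℕ) :
    min (Fintype.card G) (ballBound p t) ≤ #(t • S) := by
  induction t with
  | zero => simp [ballBound]
  | succ t ih =>
    rw [succ_nsmul]
    by_cases hu : t • S + S = univ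
    · simp [hu]
    have hne : (t • S).Nonempty := ⟨0, zero_mem_nsmul h0⟩
    have h := two_mul_card_add_card_le_of_add_ne_univ h0 hneg hS hne hu
    cases t with
    | zero => simp [ballBound, hp]
    | succ t =>
      simp only [ballBound] at ih ⊢
      rw [add_mul]
      omega

lemma le_ballBound (p t : ℕ) (hp : 1 ≤ p) : t ≤ ballBound p t := by
  cases t with
  | zero => simp
  | succ t =>
    have : t * 1 ≤ t * ((p + 1) / 2) := Nat.mul_le_mul_left _ (by omega)
    simp only [ballBound]
    omega

end growth

section olson

variable {G : Type*} [AddCommGroup G] [DecidableEq G]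

lemma escapeCard_le_of_mem_nsmul {B S : Finset G} {m : ℕ} (hm : ∀ x ∈ S, escapeCard B x ≤ m)
    {t : ℕ} {x : G} (hx : x ∈ t • S) : escapeCard B x ≤ m * t := by
  induction t generalizing x with
  | zero =>
    rw [zero_nsmul, mem_zero] at hx
    simp [hx, escapeCard_zero]
  | succ t ih =>
    rw [succ_nsmul] at hx
    obtain ⟨y, hy, s, hs, rfl⟩ := mem_add.1 hx
    have h₁ := escapeCard_add_le B y s
    have h₂ := ih hy
    have h₃ := hm s hs
    rw [Nat.mul_succ]
    omega

/-- A monotone sequence of finite sets that reaches size `N` admits a set of size `N`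
comparable with all its terms. -/
lemma exists_card_eq_comparable {α : Type*} [DecidableEq α] {X : ℕ → Finset α} (hX : Monotone X)
    {N : ℕ} (hN : ∃ t, N ≤ #(X t)) : ∃ Y : Finset α, #Y = N ∧ ∀ t, X t ⊆ Y ∨ Y ⊆ X t := by
  have hfind := Nat.find_spec hN
  have hlt : ∀ t < Nat.find hN, #(X t) < N := fun t ht => not_le.1 (Nat.find_min hN ht)
  generalize Nat.find hN = T at hfind hlt
  cases T with
  | zero =>
    obtain ⟨Y, hY, hYc⟩ := exists_subset_card_eq hfind
    exact ⟨Y, hYc, fun t => Or.inr (hY.trans (hX (Nat.zero_le t)))⟩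
  | succ T =>
    obtain ⟨Y, hXY, hYX, hYc⟩ :=
      exists_subsuperset_card_eq (hX T.le_succ) (hlt T T.lt_succ_self).le hfind
    refine ⟨Y, hYc, fun t => ?_⟩
    rcases le_or_gt t T with ht | ht
    · exact Or.inl ((hX ht).trans hXY)
    · exact Or.inr (hYX.trans (hX ht))

variable [Fintype G]

/-- Inequality of Olson: a bound for the escape numbers on a generating set bounds them on the
balls of the Cayley graph, whose sizes grow at least linearly. -/
lemma card_mul_sub_le_of_escapeCard_le {A B : Finset G} (h0 : (0 : G) ∉ A)
    (hA : AddSubgroup.closure (A : Set G) = ⊤) {m N : ℕ} (hN : N ≤ Fintype.card G)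
    (hm : ∀ x ∈ A, escapeCard B x ≤ m) :
    #B * (N - #B) ≤ m * ∑ t ∈ range N, (N - ballBound (#A + 1) t) := by
  set S : Finset G := insert 0 (A ∪ -A) with hSdef
  have hS0 : (0 : G) ∈ S := mem_insert_self _ _
  have hAS : insert 0 A ⊆ S := insert_subset_insert _ subset_union_left
  have hneg : -S = S := by
    ext g
    simp [hSdef, or_comm]
  have hS : AddSubgroup.closure (S : Set G) = ⊤ :=
    top_unique (hA ▸ AddSubgroup.closure_mono fun a ha => hAS (mem_insert_of_mem ha))
  have hcard : #A + 1 ≤ #S := by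
    rw [← card_insert_of_notMem h0]
    exact card_le_card hAS
  have hSm : ∀ x ∈ S, escapeCard B x ≤ m := by
    intro x hx
    simp only [hSdef, mem_insert, mem_union, mem_neg'] at hx
    rcases hx with rfl | hx | hx
    · simp [escapeCard_zero]
    · exact hm x hx
    · rw [← escapeCard_neg]
      exact hm _ hx
  have hball := fun t => ballBound_le_card_nsmul hS0 hneg hS hcard t
  have hmono : Monotone fun t : ℕ => t • S := fun a b hab => nsmul_subset_nsmul_right hS0 hab
  have hbig : N ≤ #(N • S) :=
    (le_min hN (le_ballBound _ N (by omega))).trans (hball N)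
  obtain ⟨Y, hYc, hY⟩ := exists_card_eq_comparable hmono ⟨N, hbig⟩
  have hYN : Y ⊆ N • S := by
    rcases hY N with h | h
    · exact (eq_of_subset_of_card_le h (by omega)).ge
    · exact h
  have hpoint : ∀ x ∈ Y, escapeCard B x ≤ m * #{t ∈ range N | x ∉ t • S} := by
    intro x hx
    have hex : ∃ t, x ∈ t • S := ⟨N, hYN hx⟩
    refine (escapeCard_le_of_mem_nsmul hSm (Nat.find_spec hex)).trans (Nat.mul_le_mul_left _ ?_)
    rw [← card_range (Nat.find hex)]
    refine card_le_card fun t ht => ?_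
    have ht' := mem_range.1 ht
    have hfN : Nat.find hex ≤ N := Nat.find_min' hex (hYN hx)
    exact mem_filter.2 ⟨mem_range.2 (by omega), Nat.find_min hex ht'⟩
  have hlevel : ∀ t, #{x ∈ Y | x ∉ t • S} ≤ N - ballBound (#A + 1) t := by
    intro t
    rw [← sdiff_eq_filter]
    rcases hY t with h | h
    · rw [card_sdiff_of_subset h, hYc]
      have := hball t
      omega
    · simp [sdiff_eq_empty_iff_subset.2 h]
  calc #B * (N - #B) = #B * (#Y - #B) := by rw [hYc]
    _ ≤ ∑ x ∈ Y, escapeCard B x := card_mul_sub_le_sum_escapeCard B Y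
    _ ≤ ∑ x ∈ Y, m * #{t ∈ range N | x ∉ t • S} := sum_le_sum hpoint
    _ = m * ∑ t ∈ range N, #{x ∈ Y | x ∉ t • S} := by
      rw [← mul_sum]
      congr 1
      exact sum_card_bipartiteAbove_eq_sum_card_bipartiteBelow fun x t => x ∉ t • S
    _ ≤ _ := Nat.mul_le_mul_left _ (sum_le_sum fun t _ => hlevel t)

/-- The numerical condition under which a set of size `D`, at most half of the group, has escape
number exceeding `m` at some element of a generating set of size `p - 1`. -/
def Expanding (p m D : ℕ) : Prop :=
  ∃ N, (N ≤ 2 * D ∨ N ≤ p) ∧ m * ∑ t ∈ range N, (N - ballBound p t) < D * (N - D)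

lemma exists_lt_escapeCard {A B : Finset G} (h0 : (0 : G) ∉ A)
    (hA : AddSubgroup.closure (A : Set G) = ⊤) {m : ℕ}
    (h : Expanding (#A + 1) m (min #B (Fintype.card G - #B))) :
    ∃ x ∈ A, m < escapeCard B x := by
  by_contra! hm
  obtain ⟨N, hN, hlt⟩ := h
  have hAc : #A + 1 ≤ Fintype.card G := by
    rw [← card_insert_of_notMem h0]
    exact card_le_univ _
  have hNG : N ≤ Fintype.card G := by omega
  refine hlt.not_ge ?_
  rcases min_choice #B (Fintype.card G - #B) with h' | h' <;> rw [h']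
  · exact card_mul_sub_le_of_escapeCard_le h0 hA hNG hm
  · rw [← card_compl]
    exact card_mul_sub_le_of_escapeCard_le h0 hA hNG fun x hx => by
      rw [escapeCard_compl]
      exact hm x hx

lemma expanding_of_le {p m D : ℕ} (hm : 1 ≤ m) (hp : 8 * m ≤ p) (hD : 2 * m ≤ D) :
    Expanding p m D := by
  refine ⟨2 * D, Or.inl le_rfl, ?_⟩
  set T := max 1 ((D - 1) / (2 * m)) with hT
  have hvanish : ∀ t, T ≤ t → 2 * D - ballBound p t = 0 := by
    intro t ht
    obtain ⟨s, rfl⟩ : ∃ s, t = s + 1 := ⟨t - 1, by omega⟩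
    have h₁ : (D - 1) / (2 * m) < s + 2 := by omega
    rw [Nat.div_lt_iff_lt_mul (by omega)] at h₁
    have h₂ : s * (4 * m) ≤ s * ((p + 1) / 2) := Nat.mul_le_mul_left _ (by omega)
    simp only [ballBound]
    have h₃ : (s + 2) * (2 * m) = s * (2 * m) + 4 * m := by ring
    have h₄ : s * (4 * m) = 2 * (s * (2 * m)) := by ring
    omega
  have hsum : ∑ t ∈ range (2 * D), (2 * D - ballBound p t) ≤ T * (2 * D - 1) := by
    calc _ ≤ ∑ t ∈ range (2 * D), if t ∈ range T then 2 * D - 1 else 0 := by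
          refine sum_le_sum fun t _ => ?_
          split_ifs with h
          · have : 1 ≤ ballBound p t := by cases t <;> simp only [ballBound] <;> omega
            omega
          · exact (hvanish t (by simpa using h)).le
      _ ≤ ∑ t ∈ range T, (2 * D - 1) := by
          rw [← sum_filter]
          exact sum_le_sum_of_subset fun t ht => (mem_filter.1 ht).2
      _ = _ := by simp
  have hmT : 2 * (m * T) ≤ D := by
    rcases max_choice 1 ((D - 1) / (2 * m)) with h | h <;> rw [hT, h]
    · omega
    · have := Nat.mul_div_le (D - 1) (2 * m)
      rw [← mul_assoc]
      omega
  have h₁ : 2 * (m * (T * (2 * D - 1))) ≤ D * (2 * D - 1) := by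
    calc _ = 2 * (m * T) * (2 * D - 1) := by ring
      _ ≤ _ := Nat.mul_le_mul_right _ hmT
  have h₂ := Nat.mul_le_mul_left m hsum
  have h₃ : D * (2 * D - 1) < 2 * (D * D) := by
    rw [← mul_assoc, mul_comm 2 D, mul_assoc]
    exact Nat.mul_lt_mul_of_pos_left (by omega) (by omega)
  rw [show 2 * D - D = D by omega]
  omega

lemma expanding_of_lt {p m D : ℕ}
    (h : m * ∑ t ∈ range (2 * D), (2 * D - ballBound p t) < D * D) : Expanding p m D :=
  ⟨2 * D, Or.inl le_rfl, by rwa [show 2 * D - D = D by omega]⟩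

end olson

section numeric

lemma expanding_one_of_small {p : ℕ} (hp : 4 ≤ p) (hp' : p < 8) {D : ℕ} (hD : 2 ≤ D)
    (hD' : D ≤ 12) : Expanding p 1 D := by
  refine expanding_of_lt ?_
  revert D
  interval_cases p <;> decide +kernel

lemma expanding_two_of_small {p : ℕ} (hp : 8 ≤ p) (hp' : p < 12) {D : ℕ} (hD : 4 ≤ D)
    (hD' : D ≤ 22) : Expanding p 2 D := by
  refine expanding_of_lt ?_
  revert D
  interval_cases p <;> decide +kernel

lemma expanding_three_of_small {p : ℕ} (hp : 12 ≤ p) (hp' : p < 16) {D : ℕ} (hD : 6 ≤ D)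
    (hD' : D ≤ 38) : Expanding p 3 D := by
  refine expanding_of_lt ?_
  revert D
  interval_cases p <;> decide +kernel

lemma expanding_fifteen_three {D : ℕ} (hD : 4 ≤ D) (hD' : D ≤ 38) : Expanding 15 3 D := by
  rcases lt_or_ge D 6 with h | h
  · refine ⟨15, Or.inr le_rfl, ?_⟩
    interval_cases D <;> decide +kernel
  · exact expanding_three_of_small (by norm_num) (by norm_num) h hD'

end numeric

section lowerBounds

variable {G : Type*} [AddCommGroup G] [DecidableEq G]

lemma two_mul_card_subsetSum_erase_le {A : Finset G} {x : G} (hx : x ∈ A)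
    (hxc : x ∉ AddSubgroup.closure (A.erase x : Set G)) :
    2 * #(A.erase x).subsetSum ≤ #A.subsetSum := by
  conv_rhs => rw [← insert_erase hx]
  rw [subsetSum_insert_eq_union (notMem_erase x A), card_union_of_disjoint,
    card_image_of_injective _ (add_left_injective x), two_mul]
  rw [disjoint_left]
  intro g hg hg'
  obtain ⟨q, hq, rfl⟩ := mem_image.1 hg'
  refine hxc ?_
  simpa using sub_mem (mem_closure_of_mem_subsetSum hg) (mem_closure_of_mem_subsetSum hq)

lemma closure_eq_top_of_mem {A : Finset G} {x : G}
    (hA : AddSubgroup.closure (A : Set G) = ⊤)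
    (hxc : x ∈ AddSubgroup.closure (A.erase x : Set G)) :
    AddSubgroup.closure (A.erase x : Set G) = ⊤ := by
  refine top_unique (hA ▸ (AddSubgroup.closure_le _).2 fun a ha => ?_)
  by_cases h : a = x
  · exact h ▸ hxc
  · exact AddSubgroup.subset_closure (mem_coe.2 (mem_erase.2 ⟨h, ha⟩))

/-- A generating set of `c` nonzero elements has at least `2 * c - 1` subset sums, unless its
subset sums miss at most one element of the group. -/
theorem min_two_mul_card_sub_one_le_card_subsetSum [Fintype G] {A : Finset G}
    (h0 : (0 : G) ∉ A) (hA : AddSubgroup.closure (A : Set G) = ⊤) :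
    min (Fintype.card G - 1) (2 * #A - 1) ≤ #A.subsetSum := by
  induction hc : #A generalizing A with
  | zero => simp
  | succ c ih =>
    have hlt := card_lt_card_subsetSum h0
    by_contra! hsmall
    rw [lt_min_iff] at hsmall
    obtain ⟨hs₁, hs₂⟩ := hsmall
    have hexp : Expanding (#A + 1) 1 (min #A.subsetSum (Fintype.card G - #A.subsetSum)) := by
      by_cases h8 : 8 ≤ #A + 1
      · exact expanding_of_le le_rfl (by omega) (by omega)
      · exact expanding_one_of_small (by omega) (by omega) (by omega) (by omega)
    obtain ⟨x, hx, hlx⟩ := exists_lt_escapeCard h0 hA hexp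
    have hle := card_subsetSum_erase_add_le hx
    have hce := card_erase_of_mem hx
    have h0' : (0 : G) ∉ A.erase x := fun h => h0 (mem_of_mem_erase h)
    by_cases hxc : x ∈ AddSubgroup.closure (A.erase x : Set G)
    · have := ih h0' (closure_eq_top_of_mem hA hxc) (by omega)
      omega
    · have h₁ := two_mul_card_subsetSum_erase_le hx hxc
      have h₂ := card_lt_card_subsetSum h0'
      omega

lemma min_card_closure_sub_one_le_card_subsetSum [Finite G] {C : Finset G}
    (h0 : (0 : G) ∉ C) :
    min (Nat.card (AddSubgroup.closure (C : Set G)) - 1) (2 * #C - 1) ≤ #C.subsetSum := by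
  classical
  set H := AddSubgroup.closure (C : Set G) with hH
  have := Fintype.ofFinite H
  have hmap : (C.subtype (· ∈ H)).map ⟨H.subtype, H.subtype_injective⟩ = C :=
    subtype_map_of_mem fun c hc => AddSubgroup.subset_closure hc
  have hgen : AddSubgroup.closure (C.subtype (· ∈ H) : Set H) = ⊤ := by
    have : (C.subtype (· ∈ H) : Set H) = ((↑) : H → G) ⁻¹' (C : Set G) := by
      ext
      simp
    rw [this]
    exact AddSubgroup.closure_closure_coe_preimage
  have h := min_two_mul_card_sub_one_le_card_subsetSum (A := C.subtype (· ∈ H))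
    (by simpa using h0) hgen
  have hc₁ : #(C.subtype (· ∈ H)) = #C := by
    conv_rhs => rw [← hmap]
    rw [card_map]
  have hc₂ : #(C.subtype (· ∈ H)).subsetSum = #C.subsetSum := by
    conv_rhs => rw [← hmap]
    rw [subsetSum_map, card_map]
  rwa [hc₁, hc₂, ← Nat.card_eq_fintype_card] at h

lemma card_le_two_mul_card_of_closure_insert [Finite G] {C : Finset G} {x y : G}
    (hgen : AddSubgroup.closure ((insert x (insert y C) : Finset G) : Set G) = ⊤)
    (hsub : x - y ∈ AddSubgroup.closure (C : Set G))
    (hadd : x + y ∈ AddSubgroup.closure (C : Set G)) :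
    Nat.card G ≤ 2 * Nat.card (AddSubgroup.closure (C : Set G)) := by
  set H := AddSubgroup.closure (C : Set G) with hH
  have hxx : x + x ∈ H := by
    simpa using add_mem hsub hadd
  have hcover : ∀ g : G, g ∈ H ∨ g + x ∈ H := by
    intro g
    have hg : g ∈ AddSubgroup.closure ((insert x (insert y C) : Finset G) : Set G) :=
      hgen ▸ AddSubgroup.mem_top g
    induction hg using AddSubgroup.closure_induction with
    | mem a ha =>
      simp only [coe_insert, Set.mem_insert_iff, mem_coe] at ha
      rcases ha with rfl | rfl | ha
      · exact Or.inr hxx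
      · exact Or.inr (by rwa [add_comm])
      · exact Or.inl (AddSubgroup.subset_closure ha)
    | zero => exact Or.inl (zero_mem H)
    | add a b _ _ ha hb =>
      rcases ha with ha | ha <;> rcases hb with hb | hb
      · exact Or.inl (add_mem ha hb)
      · exact Or.inr (by simpa [add_assoc] using add_mem ha hb)
      · exact Or.inr (by simpa [add_right_comm] using add_mem ha hb)
      · refine Or.inl ?_
        have := sub_mem (add_mem ha hb) hxx
        rwa [show a + x + (b + x) - (x + x) = a + b by abel] at this
    | neg a _ ha =>
      rcases ha with ha | ha
      · exact Or.inl (neg_mem ha)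
      · refine Or.inr ?_
        have := sub_mem hxx ha
        rwa [show x + x - (a + x) = -a + x by abel] at this
  have huniv : (Set.univ : Set G) ⊆ (H : Set G) ∪ (fun g => g - x) '' (H : Set G) := by
    intro g _
    rcases hcover g with h | h
    · exact Or.inl h
    · exact Or.inr ⟨g + x, h, by simp⟩
  have h₁ := Set.ncard_le_ncard huniv (Set.toFinite _)
  have h₂ := Set.ncard_union_le (H : Set G) ((fun g => g - x) '' (H : Set G))
  have h₃ := Set.ncard_image_le (f := fun g => g - x) (Set.toFinite (H : Set G))
  have h₄ : (H : Set G).ncard = Nat.card H := (Nat.card_coe_set_eq _).symm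
  rw [Set.ncard_univ] at h₁
  omega

/-- Subset sums of a generating set with exactly two elements outside a proper subgroup. -/
lemma min_le_card_subsetSum_of_closure_ne_top [Finite G] {C : Finset G} {x y : G}
    (h0 : (0 : G) ∉ C) (hxy : x ≠ y)
    (hgen : AddSubgroup.closure ((insert x (insert y C) : Finset G) : Set G) = ⊤)
    (hx : x ∉ AddSubgroup.closure (C : Set G)) (hy : y ∉ AddSubgroup.closure (C : Set G)) :
    min (Nat.card G - 2) (min (3 * #C + 3) (4 * #C - 2)) ≤
      #(insert x (insert y C)).subsetSum := by
  set H := AddSubgroup.closure (C : Set G) with hH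
  have hxC : x ∉ insert y C := by
    rw [mem_insert]
    rintro (h | h)
    · exact hxy h
    · exact hx (AddSubgroup.subset_closure h)
  have hyC : y ∉ C := fun h => hy (AddSubgroup.subset_closure h)
  set Q := C.subsetSum with hQ
  have hQH : ∀ q ∈ Q, q ∈ H := fun q hq => mem_closure_of_mem_subsetSum hq
  have hcard : #C < #Q := card_lt_card_subsetSum h0
  have hQsub : Q ⊆ (insert x (insert y C)).subsetSum :=
    subsetSum_mono ((subset_insert _ _).trans (subset_insert _ _))
  have hQy : Q.image (· + y) ⊆ (insert x (insert y C)).subsetSum := by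
    refine Subset.trans ?_ (subsetSum_mono (subset_insert _ _))
    rw [subsetSum_insert_eq_union hyC]
    exact subset_union_right
  have hQx : Q.image (· + x) ⊆ (insert x (insert y C)).subsetSum := by
    rw [subsetSum_insert_eq_union hxC]
    exact (image_subset_image (subsetSum_mono (subset_insert _ _))).trans subset_union_right
  have hQxy : Q.image (· + (y + x)) ⊆ (insert x (insert y C)).subsetSum := by
    rw [subsetSum_insert_eq_union hxC, subsetSum_insert_eq_union hyC]
    refine Subset.trans ?_ subset_union_right
    intro g hg
    obtain ⟨q, hq, rfl⟩ := mem_image.1 hg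
    exact mem_image.2 ⟨q + y, mem_union_right _ (mem_image_of_mem _ hq), add_assoc _ _ _⟩
  have hdisj : ∀ u v : G, u - v ∉ H → Disjoint (Q.image (· + u)) (Q.image (· + v)) := by
    intro u v huv
    rw [disjoint_left]
    intro g hg hg'
    obtain ⟨q, hq, rfl⟩ := mem_image.1 hg
    obtain ⟨r, hr, hrq⟩ := mem_image.1 hg'
    refine huv ?_
    have : u - v = r - q := by
      rw [sub_eq_sub_iff_add_eq_add, add_comm u q, hrq]
    exact this ▸ sub_mem (hQH r hr) (hQH q hq)
  have hcardI : ∀ u : G, #(Q.image (· + u)) = #Q := fun u =>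
    card_image_of_injective _ (add_left_injective u)
  have hzero : Q.image (· + 0) = Q := by simp
  have hthree : ∀ u v : G, u ∉ H → v ∉ H → u - v ∉ H →
      Q.image (· + u) ⊆ (insert x (insert y C)).subsetSum →
      Q.image (· + v) ⊆ (insert x (insert y C)).subsetSum →
      3 * #Q ≤ #(insert x (insert y C)).subsetSum := by
    intro u v hu hv huv hu' hv'
    have hd₁ : Disjoint Q (Q.image (· + u)) := by
      have := hdisj 0 u (by simpa using hu)
      rwa [hzero] at this
    have hd₂ : Disjoint Q (Q.image (· + v)) := by
      have := hdisj 0 v (by simpa using hv)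
      rwa [hzero] at this
    have h := card_le_card (union_subset (union_subset hQsub hu') hv')
    rw [card_union_of_disjoint (disjoint_union_left.2 ⟨hd₂, hdisj u v huv⟩),
      card_union_of_disjoint hd₁, hcardI, hcardI] at h
    omega
  by_cases hs : x - y ∈ H
  · by_cases ha : x + y ∈ H
    · have h₁ : Nat.card G ≤ 2 * Nat.card H :=
        card_le_two_mul_card_of_closure_insert hgen hs ha
      have h₂ : min (Nat.card H - 1) (2 * #C - 1) ≤ #Q :=
        min_card_closure_sub_one_le_card_subsetSum h0
      have hd : Disjoint Q (Q.image (· + x)) := by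
        have := hdisj 0 x (by simpa using hx)
        rwa [hzero] at this
      have h₃ := card_le_card (union_subset hQsub hQx)
      rw [card_union_of_disjoint hd, hcardI] at h₃
      omega
    · have := hthree x (y + x) hx (by rwa [add_comm]) (by simpa using hy) hQx hQxy
      omega
  · have := hthree x y hx hy hs hQx hQy
    omega

/-- A finite set all of whose subsets missing one element generate the group. -/
def RobustlyGenerates (A : Finset G) : Prop :=
  ∀ x ∈ A, AddSubgroup.closure (A.erase x : Set G) = ⊤

lemma RobustlyGenerates.closure_eq_top {A : Finset G} (hA : RobustlyGenerates A)
    (hne : A.Nonempty) : AddSubgroup.closure (A : Set G) = ⊤ := by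
  obtain ⟨x, hx⟩ := hne
  exact top_unique (hA x hx ▸ AddSubgroup.closure_mono (by simp))

lemma RobustlyGenerates.min_le_card_subsetSum_of_not_erase [Finite G] {A : Finset G} {x : G}
    (h0 : (0 : G) ∉ A) (hA : RobustlyGenerates A) (hx : x ∈ A)
    (hAx : ¬ RobustlyGenerates (A.erase x)) :
    min (Nat.card G - 2) (min (3 * #A - 3) (4 * #A - 10)) ≤ #A.subsetSum := by
  simp only [RobustlyGenerates, not_forall] at hAx
  obtain ⟨y, hy, hne⟩ := hAx
  have hyA := mem_of_mem_erase hy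
  have hxy : x ≠ y := (ne_of_mem_erase hy).symm
  obtain ⟨C, hC⟩ : ∃ C, C = (A.erase x).erase y := ⟨_, rfl⟩
  have hins : insert x (insert y C) = A := by rw [hC, insert_erase hy, insert_erase hx]
  have hcard : #A = #C + 2 := by
    rw [hC, card_erase_of_mem hy, card_erase_of_mem hx]
    have := card_pos.2 ⟨y, hy⟩
    rw [card_erase_of_mem hx] at this
    omega
  have hyc : y ∉ AddSubgroup.closure (C : Set G) := fun h =>
    hne (closure_eq_top_of_mem (hA x hx) (hC ▸ h))
  have hxc : x ∉ AddSubgroup.closure (C : Set G) := by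
    intro h
    rw [hC, erase_right_comm] at h
    rw [erase_right_comm] at hne
    exact hne (closure_eq_top_of_mem (hA y hyA) h)
  have h := min_le_card_subsetSum_of_closure_ne_top
    (fun h => h0 (hins ▸ mem_insert_of_mem (mem_insert_of_mem h))) hxy
    (by rw [hins]; exact hA.closure_eq_top ⟨x, hx⟩) hxc hyc
  rw [hins] at h
  omega

/-- Every robustly generating set of `k` nonzero elements has at least `K` subset sums, or its
subset sums miss at most `e` elements of the group. -/
def SubsetSumBound (G : Type*) [AddCommGroup G] [DecidableEq G] (k e K : ℕ) : Prop :=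
  ∀ A : Finset G, 0 ∉ A → RobustlyGenerates A → #A = k →
    min (Nat.card G - e) K ≤ #A.subsetSum

lemma SubsetSumBound.succ [Finite G] {k e e' K K' m : ℕ} (h : SubsetSumBound G k e' K')
    (hK : K ≤ K' + m + 1) (hK₃ : K ≤ 3 * k) (hK₄ : K + 6 ≤ 4 * k) (he : 2 ≤ e)
    (hek : e ≤ k + 1) (he' : e' ≤ e + m + 1)
    (hexp : ∀ D, e + 1 ≤ D → D < K → Expanding (k + 2) m D) :
    SubsetSumBound G (k + 1) e K := by
  have := Fintype.ofFinite G
  intro A h0 hA hk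
  have hlt := card_lt_card_subsetSum h0
  by_contra! hsmall
  rw [lt_min_iff] at hsmall
  obtain ⟨hs₁, hs₂⟩ := hsmall
  have hcard : Nat.card G = Fintype.card G := Nat.card_eq_fintype_card
  have hne : A.Nonempty := card_pos.1 (by omega)
  obtain ⟨x, hx, hlx⟩ := exists_lt_escapeCard (m := m) (B := A.subsetSum) h0 (hA.closure_eq_top hne)
    (by rw [hk]; exact hexp _ (by omega) (by omega))
  have hle := card_subsetSum_erase_add_le hx
  by_cases hAx : RobustlyGenerates (A.erase x)
  · have := h _ (fun h => h0 (mem_of_mem_erase h)) hAx (by rw [card_erase_of_mem hx, hk]; rfl)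
    omega
  · have := hA.min_le_card_subsetSum_of_not_erase h0 hx hAx
    omega

lemma subsetSumBound_thirteen [Finite G] : SubsetSumBound G 13 5 35 := by
  have h6 : SubsetSumBound G 6 5 11 := by
    intro A h0 hA hk
    have := Fintype.ofFinite G
    have h := min_two_mul_card_sub_one_le_card_subsetSum h0
      (hA.closure_eq_top (card_pos.1 (by omega)))
    rw [Nat.card_eq_fintype_card]
    omega
  have two : ∀ p D, 8 ≤ p → p < 12 → 5 + 1 ≤ D → D < 23 → Expanding p 2 D :=
    fun p D hp hp' hD hD' => expanding_two_of_small hp hp' (by omega) (by omega)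
  have three : ∀ p D, 12 ≤ p → p < 16 → 5 + 1 ≤ D → D < 35 → Expanding p 3 D :=
    fun p D hp hp' hD hD' => expanding_three_of_small hp hp' (by omega) (by omega)
  have h10 : SubsetSumBound G 10 5 23 := by
    refine SubsetSumBound.succ (K' := 20) (e' := 5) (m := 2) ?_ (by simp) (by simp) (by simp) (by simp)
      (by simp) (by simp) fun D hD hD' => two _ D (by simp) (by simp) hD (by omega)
    refine SubsetSumBound.succ (K' := 17) (e' := 5) (m := 2) ?_ (by simp) (by simp) (by simp) (by simp)
      (by simp) (by simp) fun D hD hD' => two _ D (by simp) (by simp) hD (by omega)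
    refine SubsetSumBound.succ (K' := 14) (e' := 5) (m := 2) ?_ (by simp) (by simp) (by simp) (by simp)
      (by simp) (by simp) fun D hD hD' => two _ D (by simp) (by simp) hD (by omega)
    exact h6.succ (m := 2) (by simp) (by simp) (by simp) (by simp)
      (by simp) (by simp) fun D hD hD' => two _ D (by simp) (by simp) hD (by omega)
  refine SubsetSumBound.succ (K' := 31) (e' := 5) (m := 3) ?_ (by simp) (by simp) (by simp)
    (by simp) (by simp) (by simp) fun D hD hD' => three _ D (by simp) (by simp) hD (by omega)
  refine SubsetSumBound.succ (K' := 27) (e' := 5) (m := 3) ?_ (by simp) (by simp) (by simp)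
    (by simp) (by simp) (by simp) fun D hD hD' => three _ D (by simp) (by simp) hD (by omega)
  exact h10.succ (m := 3) (by simp) (by simp) (by simp)
    (by simp) (by simp) (by simp) fun D hD hD' => three _ D (by simp) (by simp) hD (by omega)

theorem subsetSumBound_three_mul_sub_three [Finite G] {k : ℕ} (hk : 14 ≤ k) :
    SubsetSumBound G k 3 (3 * k - 3) := by
  induction k, hk using Nat.le_induction with
  | base =>
    exact subsetSumBound_thirteen.succ (m := 3) (by simp) (by simp) (by simp) (by simp)
      (by simp) (by simp) fun D hD hD' => expanding_fifteen_three hD (by omega)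
  | succ k hk ih =>
    exact ih.succ (m := 2) (by omega) (by omega) (by omega) (by omega) (by omega) (by omega)
      fun D hD _ => expanding_of_le (by simp) (by omega) (by omega)

end lowerBounds

lemma insert_zero_nss {G : Type*} [AddCommGroup G] [DecidableEq G] (A : Finset G) :
    insert (0 : G) (nss A) = A.subsetSum := by
  rw [nss, subsetSum, ← insert_erase (empty_mem_powerset A), image_insert, sum_empty,
    erase_insert (notMem_erase _ _)]

theorem stmt6 {G : Type*} [AddCommGroup G] [Fintype G] [DecidableEq G]
    (A : Finset G) (hA0 : (0 : G) ∉ A) (hA : 14 ≤ A.card) :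
    min (Fintype.card G - 3) (3 * A.card - 3) ≤ (insert (0 : G) (nss A)).card ∨
      ∃ H : AddSubgroup G, H ≠ ⊤ ∧ A.card - 1 ≤ ((A : Set G) ∩ (H : Set G)).ncard := by
  by_cases hrob : RobustlyGenerates A
  · left
    rw [insert_zero_nss, ← Nat.card_eq_fintype_card]
    exact subsetSumBound_three_mul_sub_three hA A hA0 hrob rfl
  · right
    simp only [RobustlyGenerates, not_forall] at hrob
    obtain ⟨x, hx, hne⟩ := hrob
    refine ⟨_, hne, ?_⟩
    rw [← card_erase_of_mem hx, ← Set.ncard_coe_finset]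
    refine Set.ncard_le_ncard (Set.subset_inter ?_ AddSubgroup.subset_closure)
      (A.finite_toSet.inter_of_left _)
    exact mod_cast erase_subset x A
end

section
/- Let p be a prime number and let A be a nonempty subset of Z_p. Then for all integers h with 1 ≤ h ≤ |A|, the set Σ_h(A) of all sums of exactly h distinct elements of A satisfies |Σ_h(A)| ≥ min(p, h|A| − h² + 1). -/
open Finset

/-- The set of all sums of exactly `h` distinct elements of `A`. -/
def nssH {G : Type*} [AddCommGroup G] [DecidableEq G] (A : Finset G) (h : ℕ) : Finset G :=
  (A.powerset.filter fun B => B.card = h).image fun B => B.sum id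

section Coefficients

open MvPolynomial

variable {R : Type*} [CommRing R]

theorem coeff_sum_X_pow_mul_prod_factorial {σ : Type*} [Fintype σ] (d : σ →₀ ℕ) :
    coeff d ((∑ i, X i : MvPolynomial σ R) ^ d.degree) * ∏ i, ((d i).factorial : R) =
      d.degree.factorial := by
  rw [coeff_sum_X_pow_of_fintype, if_pos (by rfl),
    Finsupp.multinomial_eq_of_support_subset (subset_univ d.support), mul_comm,
    Finsupp.degree_eq_sum, ← Nat.multinomial_spec univ d]
  push_cast
  rfl

theorem coeff_prod_X_pow_mul_sum_X_pow {h : ℕ} (m : ℕ) (t e : Fin h →₀ ℕ)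
    (ht : t.degree = e.degree + m) :
    coeff t ((∏ i, (X i : MvPolynomial (Fin h) R) ^ e i) * (∑ i, X i) ^ m) *
        ∏ i, ((t i).factorial : R) =
      m.factorial * ∏ i, ((t i).descFactorial (e i) : R) := by
  have hX : (∏ i, (X i : MvPolynomial (Fin h) R) ^ e i) = monomial e 1 := by
    rw [monomial_eq, C_1, one_mul, Finsupp.prod_fintype _ _ (by simp)]
  rw [hX, coeff_monomial_mul']
  split_ifs with hle
  · obtain ⟨d, rfl⟩ := exists_add_of_le hle
    have hd : d.degree = m := by
      rw [map_add] at ht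
      omega
    subst hd
    rw [add_tsub_cancel_left, one_mul, ← coeff_sum_X_pow_mul_prod_factorial, mul_assoc,
      ← Finset.prod_mul_distrib]
    congr 1
    refine Finset.prod_congr rfl fun i _ ↦ ?_
    have := Nat.factorial_mul_descFactorial (Nat.le_add_right (e i) (d i))
    rw [Nat.add_sub_cancel_left] at this
    rw [Finsupp.add_apply, ← Nat.cast_mul, this]
  · obtain ⟨i, hi⟩ : ∃ i, t i < e i := by
      simpa [Finsupp.le_def] using hle
    rw [zero_mul, Finset.prod_eq_zero (mem_univ i), mul_zero]
    rw [Nat.descFactorial_of_lt hi, Nat.cast_zero]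

theorem isHomogeneous_det_vandermonde_X (h : ℕ) :
    (Matrix.vandermonde (X : Fin h → MvPolynomial (Fin h) R)).det.IsHomogeneous
      (∑ i : Fin h, (i : ℕ)) := by
  rw [Matrix.det_apply]
  refine IsHomogeneous.sum _ _ _ fun s _ ↦ ?_
  have hprod : (∏ i, Matrix.vandermonde (X : Fin h → MvPolynomial (Fin h) R) (s i) i).IsHomogeneous
      (∑ i : Fin h, (i : ℕ)) :=
    IsHomogeneous.prod _ _ _ fun i _ ↦ isHomogeneous_X_pow _ _
  rcases Int.units_eq_one_or (Equiv.Perm.sign s) with hs | hs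
  · simpa [hs] using hprod
  · simpa [hs] using hprod.neg

theorem coeff_det_vandermonde_X_mul_sum_X_pow [IsDomain R] {h : ℕ} (m : ℕ) (t : Fin h →₀ ℕ)
    (ht : t.degree = (∑ i : Fin h, (i : ℕ)) + m) :
    coeff t ((Matrix.vandermonde (X : Fin h → MvPolynomial (Fin h) R)).det * (∑ i, X i) ^ m) *
        ∏ i, ((t i).factorial : R) =
      m.factorial * (Matrix.vandermonde fun i ↦ (t i : R)).det := by
  rw [Matrix.det_eval_matrixOfPolynomials_eq_det_vandermonde (fun i ↦ (t i : R))
    (fun j ↦ descPochhammer R j) (fun j ↦ descPochhammer_natDegree R j)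
    (fun j ↦ monic_descPochhammer R j)]
  simp_rw [descPochhammer_eval_eq_descFactorial]
  rw [Matrix.det_apply, Matrix.det_apply, Finset.sum_mul, coeff_sum, Finset.sum_mul,
    Finset.mul_sum]
  refine Finset.sum_congr rfl fun s _ ↦ ?_
  have key := coeff_prod_X_pow_mul_sum_X_pow (R := R) m t
    (Finsupp.equivFunOnFinite.symm fun j ↦ ((s.symm j : Fin h) : ℕ)) (by
      rw [ht, Finsupp.degree_eq_sum]
      congr 1
      exact (Equiv.sum_comp s.symm fun i : Fin h ↦ (i : ℕ)).symm)
  rw [← Equiv.prod_comp s, ← Equiv.prod_comp s (fun i ↦ ((Nat.descFactorial _ _ : ℕ) : R))] at key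
  simp only [Finsupp.equivFunOnFinite_symm_apply_apply, Equiv.symm_apply_apply] at key
  simp only [Matrix.vandermonde_apply, Matrix.of_apply]
  rcases Int.units_eq_one_or (Equiv.Perm.sign s) with hs | hs
  · simpa [hs] using key
  · simpa [hs] using key

end Coefficients

theorem sum_range_add_div (h m : ℕ) (hh : 0 < h) : ∑ i ∈ range h, (m + i) / h = m := by
  induction m with
  | zero =>
    refine Finset.sum_eq_zero fun i hi ↦ ?_
    rw [zero_add]
    exact Nat.div_eq_of_lt (mem_range.1 hi)
  | succ m ih =>
    have h₁ := Finset.sum_range_succ (fun i ↦ (m + i) / h) h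
    have h₂ := Finset.sum_range_succ' (fun i ↦ (m + i) / h) h
    rw [ih, Nat.add_div_right _ hh] at h₁
    simp only [add_zero, ← add_assoc, Nat.add_right_comm m _ 1] at h₂
    omega

section Sumset

open MvPolynomial

theorem exists_injective_sum_notMem {F : Type*} [Field F] {h : ℕ} (A S : Finset F)
    (t : Fin h →₀ ℕ) (htA : ∀ i, t i < #A) (ht : t.degree = (∑ i : Fin h, (i : ℕ)) + #S)
    (hS : ((#S).factorial : F) ≠ 0) (hinj : Function.Injective fun i ↦ (t i : F)) :
    ∃ x : Fin h → F, Function.Injective x ∧ (∀ i, x i ∈ A) ∧ ∑ i, x i ∉ S := by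
  set V := (Matrix.vandermonde (X : Fin h → MvPolynomial (Fin h) F)).det with hV
  set D := ∑ i : Fin h, (i : ℕ)
  set g : Polynomial F := ∏ s ∈ S, (Polynomial.X - Polynomial.C s) with hg
  have hgm : g.Monic := Polynomial.monic_prod_of_monic _ _ fun s _ ↦ Polynomial.monic_X_sub_C s
  have hgd : g.natDegree = #S := by simp [hg]
  have hhom (i : ℕ) : (V * (∑ j, X j) ^ i).IsHomogeneous (D + i) := by
    have := (isHomogeneous_det_vandermonde_X h).mul
      ((IsHomogeneous.sum univ _ 1 fun j _ ↦ isHomogeneous_X F j).pow i)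
    rwa [one_mul] at this
  set f := V * Polynomial.aeval (∑ j, X j) g with hf
  have hfs : f = ∑ i ∈ range (#S + 1), C (g.coeff i) * (V * (∑ j, X j) ^ i) := by
    rw [hf, Polynomial.aeval_eq_sum_range, hgd, Finset.mul_sum]
    refine Finset.sum_congr rfl fun i _ ↦ ?_
    rw [smul_eq_C_mul]
    ring
  have hcoeff : coeff t f = coeff t (V * (∑ j, X j) ^ #S) := by
    rw [hfs, coeff_sum, Finset.sum_range_succ, Finset.sum_eq_zero, zero_add, coeff_C_mul,
      ← hgd, hgm.coeff_natDegree, one_mul]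
    intro i hi
    rw [coeff_C_mul, (hhom i).coeff_eq_zero, mul_zero]
    have := mem_range.1 hi
    omega
  have hne : coeff t f ≠ 0 := by
    intro h0
    have := coeff_det_vandermonde_X_mul_sum_X_pow (R := F) #S t ht
    rw [← hV, ← hcoeff, h0, zero_mul, eq_comm, mul_eq_zero] at this
    exact this.elim hS (Matrix.det_vandermonde_ne_zero_iff.2 hinj)
  have hdeg : f.totalDegree = t.degree := by
    refine le_antisymm ?_ ?_
    · rw [hfs]
      refine totalDegree_finsetSum_le fun i hi ↦ ?_
      have := mem_range.1 hi
      exact (((hhom i).C_mul _).totalDegree_le).trans (by omega)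
    · exact le_totalDegree (mem_support_iff.2 hne)
  obtain ⟨x, hxA, hx⟩ := combinatorial_nullstellensatz_exists_eval_nonzero f t hne hdeg
    (fun _ ↦ A) htA
  rw [hf, map_mul, mul_ne_zero_iff] at hx
  refine ⟨x, ?_, hxA, fun hxS ↦ hx.2 ?_⟩
  · rw [← Matrix.det_vandermonde_ne_zero_iff]
    convert hx.1
    rw [hV, RingHom.map_det]
    congr 1
    ext i j
    simp [Matrix.vandermonde_apply]
  · simp only [hg, map_prod, map_sub, Polynomial.aeval_X, Polynomial.aeval_C]
    refine Finset.prod_eq_zero hxS ?_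
    simp [algebraMap_eq]

end Sumset

theorem stmt8 {p : ℕ} (hp : p.Prime) (A : Finset (ZMod p)) (hA : A.Nonempty) :
    ∀ h : ℕ, 1 ≤ h → h ≤ A.card →
      min p (h * A.card - h ^ 2 + 1) ≤ (nssH A h).card := by
  intro h hh hhA
  have : Fact p.Prime := ⟨hp⟩
  by_contra! hlt
  obtain ⟨hmp, hm⟩ := lt_min_iff.1 hlt
  set S := nssH A h
  have hAp : #A ≤ p := (card_le_univ A).trans_eq (ZMod.card p)
  have hm' : #S ≤ h * (#A - h) := by
    rw [Nat.mul_sub, ← pow_two]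
    omega
  set t : Fin h →₀ ℕ := Finsupp.equivFunOnFinite.symm fun i ↦ (i : ℕ) + (#S + i) / h with ht
  have htA (i : Fin h) : t i < #A := by
    have h₁ : (#S + i) / h < #A - h + 1 := by
      rw [Nat.div_lt_iff_lt_mul hh, add_mul, mul_comm]
      omega
    have : t i = i + (#S + i) / h := rfl
    omega
  have hmono : StrictMono t := fun i j hij ↦
    add_lt_add_of_lt_of_le hij (Nat.div_le_div_right (Nat.add_le_add_left hij.le _))
  obtain ⟨x, hx, hxA, hxS⟩ := exists_injective_sum_notMem A S t htA
    (by
      rw [Finsupp.degree_eq_sum]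
      simp only [ht, Finsupp.equivFunOnFinite_symm_apply_apply, sum_add_distrib]
      rw [Fin.sum_univ_eq_sum_range (fun i ↦ (#S + i) / h), sum_range_add_div h _ hh])
    (by
      rw [Ne, ZMod.natCast_eq_zero_iff, hp.dvd_factorial]
      omega)
    (fun i j hij ↦ hmono.injective (by
      have := (ZMod.natCast_eq_natCast_iff' _ _ _).1 hij
      rwa [Nat.mod_eq_of_lt ((htA i).trans_le hAp), Nat.mod_eq_of_lt ((htA j).trans_le hAp)]
        at this))
  refine hxS (mem_image.2 ⟨univ.image x, ?_, ?_⟩)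
  · rw [mem_filter, mem_powerset, card_image_of_injective _ hx, card_fin]
    exact ⟨image_subset_iff.2 fun i _ ↦ hxA i, rfl⟩
  · rw [sum_image hx.injOn]
    rfl
end

section
/- Let A be a nonempty finite subset of an abelian group with 0 ∉ A. Then |Σ(A)| ≥ min(|⟨A⟩|, 2|A| − 1), where ⟨A⟩ is the subgroup generated by A. -/
open Finset

theorem closure_subset_of_add_sub_mem {G : Type*} [AddCommGroup G] {A T : Finset G} (h0 : (0 : G) ∈ T)
    (hadd : ∀ a ∈ A, ∀ x ∈ T, x + a ∈ T) (hsub : ∀ a ∈ A, ∀ x ∈ T, x - a ∈ T) {x : G}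
    (hx : x ∈ AddSubgroup.closure (A : Set G)) : x ∈ T := by
  induction hx using AddSubgroup.closure_induction_right with
  | zero => exact h0
  | add_right x _ a ha h => exact hadd a ha x h
  | add_neg_cancel x _ a ha h => rw [← sub_eq_add_neg]; exact hsub a ha x h

section

variable {G : Type*} [AddCommGroup G] [DecidableEq G]

/-- The set of all subset sums of `A`, the empty sum included. -/
def allSubsetSums (A : Finset G) : Finset G :=
  A.powerset.image fun B => B.sum id

theorem mem_allSubsetSums {A : Finset G} {x : G} :
    x ∈ allSubsetSums A ↔ ∃ B ⊆ A, B.sum id = x := by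
  simp [allSubsetSums]

theorem zero_mem_allSubsetSums (A : Finset G) : (0 : G) ∈ allSubsetSums A :=
  mem_allSubsetSums.2 ⟨∅, by simp, by simp⟩

theorem subset_allSubsetSums (A : Finset G) : A ⊆ allSubsetSums A := fun a ha =>
  mem_allSubsetSums.2 ⟨{a}, by simpa using ha, by simp⟩

theorem allSubsetSums_mono {A B : Finset G} (h : A ⊆ B) :
    allSubsetSums A ⊆ allSubsetSums B := fun x hx => by
  obtain ⟨C, hC, rfl⟩ := mem_allSubsetSums.1 hx
  exact mem_allSubsetSums.2 ⟨C, hC.trans h, rfl⟩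

theorem add_mem_allSubsetSums {A B C : Finset G} (h : Disjoint B C) (hB : B ⊆ A) (hC : C ⊆ A)
    {x y : G} (hx : x ∈ allSubsetSums B) (hy : y ∈ allSubsetSums C) :
    x + y ∈ allSubsetSums A := by
  obtain ⟨D, hD, rfl⟩ := mem_allSubsetSums.1 hx
  obtain ⟨E, hE, rfl⟩ := mem_allSubsetSums.1 hy
  exact mem_allSubsetSums.2 ⟨D ∪ E, union_subset (hD.trans hB) (hE.trans hC),
    sum_union (disjoint_of_subset_left hD (disjoint_of_subset_right hE h))⟩

theorem exists_add_of_mem_allSubsetSums {A : Finset G} (B : Finset G) {x : G}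
    (hx : x ∈ allSubsetSums A) :
    ∃ y ∈ allSubsetSums B, ∃ z ∈ allSubsetSums (A \ B), y + z = x := by
  obtain ⟨D, hD, rfl⟩ := mem_allSubsetSums.1 hx
  refine ⟨(D ∩ B).sum id, mem_allSubsetSums.2 ⟨_, inter_subset_right, rfl⟩,
    (D \ B).sum id, mem_allSubsetSums.2 ⟨_, sdiff_subset_sdiff hD le_rfl, rfl⟩, ?_⟩
  rw [add_comm, ← sum_union (disjoint_sdiff_inter D B), sdiff_union_inter]

theorem sum_sub_mem_allSubsetSums {A : Finset G} {x : G} (hx : x ∈ allSubsetSums A) :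
    A.sum id - x ∈ allSubsetSums A := by
  obtain ⟨D, hD, rfl⟩ := mem_allSubsetSums.1 hx
  exact mem_allSubsetSums.2 ⟨A \ D, sdiff_subset, by rw [← sum_sdiff hD]; abel⟩

theorem add_mem_of_mem_erase {A : Finset G} {a x : G} (ha : a ∈ A)
    (hx : x ∈ allSubsetSums (A.erase a)) : x + a ∈ allSubsetSums A := by
  refine add_mem_allSubsetSums (B := A.erase a) (C := {a}) (by simp) (erase_subset _ _)
    (by simpa using ha) hx (subset_allSubsetSums _ (by simp))

theorem mem_erase_or_sub_mem_erase {A : Finset G} {a x : G}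
    (hx : x ∈ allSubsetSums A) :
    x ∈ allSubsetSums (A.erase a) ∨ x - a ∈ allSubsetSums (A.erase a) := by
  obtain ⟨D, hD, rfl⟩ := mem_allSubsetSums.1 hx
  by_cases h : a ∈ D
  · exact Or.inr (mem_allSubsetSums.2 ⟨D.erase a, erase_subset_erase a hD,
      by rw [← add_sum_erase D id h]; simp⟩)
  · exact Or.inl (mem_allSubsetSums.2 ⟨D, subset_erase.2 ⟨hD, h⟩, rfl⟩)

theorem sum_sub_mem_erase {A : Finset G} {a x : G} (ha : a ∈ A)
    (hx : x ∈ allSubsetSums (A.erase a)) :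
    A.sum id - a - x ∈ allSubsetSums (A.erase a) := by
  have := sum_sub_mem_allSubsetSums hx
  rwa [← add_sum_erase A id ha, id_eq, add_sub_cancel_left]

theorem allSubsetSums_subset_closure (A : Finset G) {x : G} (hx : x ∈ allSubsetSums A) :
    x ∈ AddSubgroup.closure (A : Set G) := by
  obtain ⟨D, hD, rfl⟩ := mem_allSubsetSums.1 hx
  exact sum_mem fun a ha => AddSubgroup.subset_closure (hD ha)

theorem closure_subset_allSubsetSums {A : Finset G}
    (hadd : ∀ a ∈ A, ∀ x ∈ allSubsetSums A, x + a ∈ allSubsetSums A) {x : G}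
    (hx : x ∈ AddSubgroup.closure (A : Set G)) : x ∈ allSubsetSums A := by
  refine closure_subset_of_add_sub_mem (zero_mem_allSubsetSums A) hadd (fun a ha x hx => ?_) hx
  have := sum_sub_mem_allSubsetSums (hadd a ha _ (sum_sub_mem_allSubsetSums hx))
  rwa [show A.sum id - (A.sum id - x + a) = x - a by abel] at this

/-- A set without nonempty zero-sum subsets has at least `2 * |A|` subset sums. -/
theorem two_mul_card_le_of_zeroSumFree (A : Finset G) (hne : A.Nonempty)
    (hA : ∀ B ⊆ A, B.sum id = 0 → B = ∅) : 2 * A.card ≤ (allSubsetSums A).card := by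
  induction A using Finset.strongInduction with
  | H A ih =>
  have hs : ∀ q ∈ A, A.sum id ∉ allSubsetSums (A.erase q) := by
    intro q hq h
    obtain ⟨C, hC, hsum⟩ := mem_allSubsetSums.1 h
    have hCA := hC.trans (erase_subset _ _)
    have h0 : (A \ C).sum id = 0 := by
      have := sum_sdiff (f := id) hCA
      rw [hsum] at this
      simpa using this
    have := hA _ sdiff_subset h0
    have hqC : q ∈ C := sdiff_eq_empty_iff_subset.1 this hq
    simpa using hC hqC
  have hsX : A.sum id ∈ allSubsetSums A := mem_allSubsetSums.2 ⟨A, le_rfl, rfl⟩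
  have hs0 : A.sum id ≠ 0 := fun h => hne.ne_empty (hA A le_rfl h)
  by_contra! hlt
  obtain ⟨p, hp⟩ := hne
  by_cases hex : ∃ r ∈ A, r ≠ p
  · obtain ⟨r, hr, hrp⟩ := hex
    have hins : ∀ q ∈ A, (A.erase q).Nonempty →
        allSubsetSums A = insert (A.sum id) (allSubsetSums (A.erase q)) := by
      intro q hq hqne
      have h1 := ih _ (erase_ssubset hq) hqne fun B hB => hA B (hB.trans (erase_subset _ _))
      symm
      refine eq_of_subset_of_card_le
        (insert_subset hsX (allSubsetSums_mono (erase_subset _ _))) ?_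
      rw [card_insert_of_notMem (hs q hq)]
      rw [card_erase_of_mem hq] at h1
      omega
    have hXp := hins p hp ⟨r, by simp [hr, hrp]⟩
    have hXr := hins r hr ⟨p, by simp [hp, hrp.symm]⟩
    have hmem : ∀ x, x ∈ allSubsetSums A → x ≠ A.sum id →
        x ∈ allSubsetSums (A.erase p) ∧ x ∈ allSubsetSums (A.erase r) := fun x hx hxs =>
      ⟨by rw [hXp] at hx; exact mem_of_mem_insert_of_ne hx hxs,
        by rw [hXr] at hx; exact mem_of_mem_insert_of_ne hx hxs⟩
    have h2 := sum_sub_mem_erase hp (zero_mem_allSubsetSums (A.erase p))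
    have h3 := (hmem _ (allSubsetSums_mono (erase_subset _ _) h2) (by
      rintro h; exact hs p hp (h ▸ h2))).2
    have h4 := add_mem_of_mem_erase hr h3
    have h5 := (hmem _ h4 (by
      intro h
      apply hrp
      have : A.sum id - p - 0 + r - A.sum id + p = p := by rw [h]; abel
      rw [← this]; abel)).1
    have h6 := sum_sub_mem_erase hp h5
    have h7 := (hmem _ (allSubsetSums_mono (erase_subset _ _) h6) (by
      rintro h; exact hs p hp (h ▸ h6))).2
    have h8 := sum_sub_mem_erase hr h7
    refine hs r hr ?_
    rwa [show A.sum id - r - (A.sum id - p - (A.sum id - p - 0 + r)) = A.sum id by abel] at h8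
  · push Not at hex
    obtain rfl : A = {p} := eq_singleton_iff_unique_mem.2 ⟨hp, hex⟩
    rw [sum_singleton, id_eq] at hs0
    have hsub : {0, p} ⊆ allSubsetSums {p} :=
      insert_subset (zero_mem_allSubsetSums _) (subset_allSubsetSums _)
    have := card_le_card hsub
    rw [card_pair hs0.symm] at this
    rw [card_singleton] at hlt
    omega

/-- If `h ≠ 0` is a period of the set of subset sums of `A`, then this set either is all of the
subgroup generated by `A` or has at least `2 * |A| - 1` elements. -/
theorem closure_subset_or_two_mul_card_le_of_period {A : Finset G} (hA0 : (0 : G) ∉ A) {h : G}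
    (hh : h ≠ 0) (hper : ∀ x ∈ allSubsetSums A, x + h ∈ allSubsetSums A) :
    (∀ x ∈ AddSubgroup.closure (A : Set G), x ∈ allSubsetSums A) ∨
      2 * A.card ≤ (allSubsetSums A).card + 1 := by
  classical
  set X := allSubsetSums A with hX
  set F := X.filter fun k => ∀ x ∈ X, x + k ∈ X with hF
  have memF : ∀ k, k ∈ F ↔ ∀ x ∈ X, x + k ∈ X := fun k => by
    simp only [hF, mem_filter, and_iff_right_iff_imp]
    intro hk
    simpa using hk 0 (zero_mem_allSubsetSums A)
  have h0F : (0 : G) ∈ F := (memF 0).2 (by simp)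
  have addF : ∀ k ∈ F, ∀ l ∈ F, k + l ∈ F := fun k hk l hl => (memF _).2 fun x hx => by
    rw [← add_assoc]
    exact (memF l).1 hl _ ((memF k).1 hk x hx)
  have negF : ∀ k ∈ F, -k ∈ F := fun k hk => (memF _).2 fun x hx => by
    have := sum_sub_mem_allSubsetSums ((memF k).1 hk _ (sum_sub_mem_allSubsetSums hx))
    rwa [show A.sum id - (A.sum id - x + k) = x + -k by abel] at this
  have grow : ∀ B : Finset G, B ⊆ A \ F →
      F.card * (1 + B.card) ≤ (image₂ (· + ·) (allSubsetSums B) F).card := by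
    intro B
    induction B using Finset.induction_on with
    | empty =>
      intro _
      have : F ⊆ image₂ (· + ·) (allSubsetSums (∅ : Finset G)) F := fun k hk =>
        mem_image₂.2 ⟨0, zero_mem_allSubsetSums _, k, hk, zero_add k⟩
      simpa using card_le_card this
    | insert b B hb ih =>
      intro hBA
      have hBA' : B ⊆ A \ F := (subset_insert _ _).trans hBA
      have hbAF := mem_sdiff.1 (hBA (mem_insert_self b B))
      have hBsub : B ⊆ A := hBA'.trans sdiff_subset
      have hbB : b ∈ A \ B := mem_sdiff.2 ⟨hbAF.1, hb⟩
      set T := image₂ (· + ·) (allSubsetSums B) F with hT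
      have hTF : ∀ t ∈ T, ∀ k ∈ F, t + k ∈ T := by
        intro t ht k hk
        obtain ⟨x, hx, l, hl, rfl⟩ := mem_image₂.1 ht
        exact mem_image₂.2 ⟨x, hx, l + k, addF l hl k hk, (add_assoc x l k).symm⟩
      obtain ⟨t, ht, htb⟩ : ∃ t ∈ T, t + b ∉ T := by
        by_contra! hcon
        refine hbAF.2 ((memF b).2 fun x hx => ?_)
        obtain ⟨y, hy, z, hz, rfl⟩ := exists_add_of_mem_allSubsetSums B hx
        obtain ⟨y', hy', k, hk, e⟩ := mem_image₂.1
          (hcon y (mem_image₂.2 ⟨y, hy, 0, h0F, add_zero y⟩))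
        rw [show y + z + b = y' + z + k by
          rw [add_right_comm y z b, ← e]; abel]
        exact (memF k).1 hk _
          (add_mem_allSubsetSums disjoint_sdiff hBsub sdiff_subset hy' hz)
      have hdisj : Disjoint T (F.image fun k => t + b + k) := by
        rw [disjoint_left]
        intro u hu hu'
        obtain ⟨k, hk, rfl⟩ := mem_image.1 hu'
        apply htb
        have := hTF _ hu _ (negF k hk)
        rwa [add_neg_cancel_right] at this
      have hsub : T ∪ (F.image fun k => t + b + k) ⊆
          image₂ (· + ·) (allSubsetSums (insert b B)) F := by
        refine union_subset (image₂_subset_right (allSubsetSums_mono (subset_insert _ _))) ?_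
        intro u hu
        obtain ⟨k, hk, rfl⟩ := mem_image.1 hu
        obtain ⟨x, hx, l, hl, rfl⟩ := mem_image₂.1 ht
        refine mem_image₂.2 ⟨x + b, ?_, l + k, addF l hl k hk, by abel⟩
        refine add_mem_of_mem_erase (mem_insert_self b B) ?_
        rwa [erase_insert hb]
      have hcard := card_le_card hsub
      rw [card_union_of_disjoint hdisj, card_image_of_injective _ (add_right_injective _)] at hcard
      have := ih hBA'
      rw [card_insert_of_notMem hb]
      linarith
  have hXcard : F.card * (1 + (A \ F).card) ≤ X.card := by
    refine (grow _ le_rfl).trans (card_le_card fun u hu => ?_)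
    obtain ⟨x, hx, k, hk, rfl⟩ := mem_image₂.1 hu
    exact (memF k).1 hk x (allSubsetSums_mono sdiff_subset hx)
  have hF2 : 2 ≤ F.card := by
    rw [← card_pair hh.symm]
    exact card_le_card (insert_subset h0F (by simpa using (memF h).2 hper))
  have hAF : (A ∩ F).card + 1 ≤ F.card := by
    have hsub : insert 0 (A ∩ F) ⊆ F := insert_subset h0F inter_subset_right
    have := card_le_card hsub
    rwa [card_insert_of_notMem (by simp [hA0])] at this
  have hsplit := card_sdiff_add_card_inter A F
  rcases Nat.eq_zero_or_pos (A \ F).card with hm | hm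
  · left
    rw [card_eq_zero, sdiff_eq_empty_iff_subset] at hm
    exact fun x hx => closure_subset_allSubsetSums (fun a ha => (memF a).1 (hm ha)) hx
  · right
    nlinarith

/-- If removing any single element `a` of `A` loses exactly one subset sum `v a`, the set of subset
sums has no nonzero period, and `A` has two elements that differ even up to sign, then the subset
sums form the subgroup generated by `A` with one element removed. -/
theorem exists_insert_eq_closure {A : Finset G} (hA0 : (0 : G) ∉ A) {v : G → G}
    (hv : ∀ a ∈ A, v a ∈ allSubsetSums A)
    (hmem : ∀ a ∈ A, ∀ x, x ∈ allSubsetSums (A.erase a) ↔ x ∈ allSubsetSums A ∧ x ≠ v a)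
    (hper : ∀ h : G, (∀ x ∈ allSubsetSums A, x + h ∈ allSubsetSums A) → h = 0)
    {p r : G} (hp : p ∈ A) (hr : r ∈ A) (hrp : r ≠ p) (hrp' : r ≠ -p) :
    ∃ y ∉ allSubsetSums A,
      ∀ x, x ∈ AddSubgroup.closure (A : Set G) ↔ x ∈ insert y (allSubsetSums A) := by
  set X := allSubsetSums A with hX
  set s := A.sum id with hs
  have refl_mem : ∀ x ∈ X, s - x ∈ X := fun x hx => sum_sub_mem_allSubsetSums hx
  have refl_erase : ∀ a ∈ A, ∀ x ∈ X, x ≠ v a → s - a - x ∈ X ∧ s - a - x ≠ v a :=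
    fun a ha x hx hxv => (hmem a ha _).1 (sum_sub_mem_erase ha ((hmem a ha x).2 ⟨hx, hxv⟩))
  have add_mem : ∀ a ∈ A, ∀ x ∈ X, x ≠ v a → x + a ∈ X := fun a ha x hx hxv =>
    add_mem_of_mem_erase ha ((hmem a ha x).2 ⟨hx, hxv⟩)
  have sub_mem : ∀ a ∈ A, ∀ x ∈ X, x ≠ s - v a → x - a ∈ X := by
    intro a ha x hx hxv
    have := refl_mem _ (add_mem a ha _ (refl_mem x hx) fun e => hxv (by rw [← e]; abel))
    rwa [show s - (s - x + a) = x - a by abel] at this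
  have ne0 : ∀ a ∈ A, a ≠ 0 := fun a ha h => hA0 (h ▸ ha)
  have v_add : ∀ a ∈ A, v a + a ∉ X := by
    intro a ha h
    refine ne0 a ha (hper a fun x hx => ?_)
    by_cases hxv : x = v a
    · rwa [hxv]
    · exact add_mem a ha x hx hxv
  have v_ne : ∀ a ∈ A, v a ≠ s - v a := by
    intro a ha h
    have h1 : v a ∈ allSubsetSums (A.erase a) ∨ v a - a ∈ allSubsetSums (A.erase a) :=
      mem_erase_or_sub_mem_erase (hv a ha)
    rw [hmem a ha, hmem a ha] at h1
    obtain ⟨h1, h2⟩ := h1.resolve_left fun h => h.2 rfl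
    apply (refl_erase a ha _ h1 h2).2
    rw [show s - a - (v a - a) = s - v a by abel, ← h]
  have v_inj : ∀ p ∈ A, ∀ r ∈ A, r ≠ p → v p ≠ v r := by
    intro p hp r hr hrp e
    have h1 := refl_erase p hp _ (refl_mem _ (hv p hp)) (v_ne p hp).symm
    have h2 := refl_erase r hr _ h1.1 (e ▸ h1.2)
    have h3 := refl_mem _ h2.1
    have h4 := refl_erase p hp _ h3 fun e' => hrp (by
      have : s - (s - r - (s - p - (s - v p))) - v p + p = r := by abel
      rw [e', sub_self, zero_add] at this
      exact this.symm)
    have h5 := refl_erase r hr _ h4.1 (e ▸ h4.2)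
    apply h5.2
    rw [← e]
    abel
  have v_ne_refl : ∀ p ∈ A, ∀ r ∈ A, r ≠ -p → v p ≠ s - v r := by
    intro p hp r hr hrp e
    have e' : v r = s - v p := by rw [e, sub_sub_cancel]
    have h1 := refl_erase p hp _ (refl_mem _ (hv p hp)) (v_ne p hp).symm
    have h2 := refl_erase r hr _ (refl_mem _ h1.1) fun h => h1.2 (sub_right_injective (h.trans e'))
    have h3 := refl_erase p hp _ h2.1 fun h => hrp (by
      have : s - r - (s - (s - p - (s - v p))) = v p - (r + p) := by abel
      rw [this, sub_eq_self] at h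
      exact eq_neg_of_add_eq_zero_left h)
    have h4 := refl_erase r hr _ (refl_mem _ h3.1) fun h => h3.2 (sub_right_injective (h.trans e'))
    apply h4.2
    rw [e']
    abel
  have pair : ∀ p ∈ A, ∀ r ∈ A, r ≠ p → r ≠ -p →
      v p + p = v r + r ∧ v p + p + r = s - v r := by
    intro p hp r hr hrp hrp'
    constructor
    · have h1 := sub_mem r hr _ (hv p hp) (v_ne_refl p hp r hr hrp')
      have h2 := add_mem p hp _ h1 fun e => ne0 r hr (by simpa using e)
      by_contra hne
      have h3 := add_mem r hr _ h2 fun e => hne (by rw [← e]; abel)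
      exact v_add p hp (by rwa [show v p - r + p + r = v p + p by abel] at h3)
    · have h1 := add_mem r hr _ (hv p hp) (v_inj p hp r hr hrp)
      have h2 := add_mem p hp _ h1 fun e => ne0 r hr (by simpa using e)
      by_contra hne
      have h3 := sub_mem r hr _ h2 fun e => hne (by rw [← e]; abel)
      exact v_add p hp (by rwa [show v p + r + p - r = v p + p by abel] at h3)
  have hpr := pair p hp r hr hrp hrp'
  have hrp2 := pair r hr p hp hrp.symm fun e => hrp' (by rw [e, neg_neg])
  have key : ∀ q ∈ A, v q + q = v r + r ∧ v r + r + q = s - v q := by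
    have main : ∀ q ∈ A, ∀ t ∈ A, t ≠ q → t ≠ -q → v t + t = v r + r →
        v q + q = v r + r ∧ v r + r + q = s - v q := by
      intro q hq t ht h1 h2 h3
      refine ⟨(pair q hq t ht h1 h2).1.trans h3, ?_⟩
      rw [← h3]
      exact (pair t ht q hq h1.symm fun e => h2 (by rw [e, neg_neg])).2
    intro q hq
    by_cases h : r = q ∨ r = -q
    · refine main q hq p hp ?_ ?_ hpr.1
      · rintro rfl
        exact h.elim hrp hrp'
      · rintro rfl
        rw [neg_neg] at hrp'
        exact h.elim hrp' hrp
    · push Not at h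
      exact main q hq r hr h.1 h.2 rfl
  refine ⟨v r + r, v_add r hr, fun x => ⟨fun hx => ?_, fun hx => ?_⟩⟩
  · refine closure_subset_of_add_sub_mem
      (mem_insert_of_mem (zero_mem_allSubsetSums A)) ?_ ?_ hx
    · intro a ha x hx
      rcases mem_insert.1 hx with rfl | hx
      · rw [(key a ha).2]
        exact mem_insert_of_mem (refl_mem _ (hv a ha))
      · by_cases hxv : x = v a
        · rw [hxv, (key a ha).1]
          exact mem_insert_self _ _
        · exact mem_insert_of_mem (add_mem a ha x hx hxv)
    · intro a ha x hx
      rcases mem_insert.1 hx with rfl | hx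
      · rw [← (key a ha).1, add_sub_cancel_right]
        exact mem_insert_of_mem (hv a ha)
      · by_cases hxv : x = s - v a
        · rw [hxv, ← (key a ha).2, add_sub_cancel_right]
          exact mem_insert_self _ _
        · exact mem_insert_of_mem (sub_mem a ha x hx hxv)
  · rcases mem_insert.1 hx with rfl | hx
    · exact AddSubgroup.add_mem _ (allSubsetSums_subset_closure A (hv r hr))
        (AddSubgroup.subset_closure hr)
    · exact allSubsetSums_subset_closure A hx

/-- The subset sums of a finite set `A` with `0 ∉ A` fill the subgroup generated by `A`, or there
are at least `2 * |A| - 1` of them. -/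
theorem closure_subset_or_two_mul_card_le (A : Finset G) (hA0 : (0 : G) ∉ A) :
    (∀ x ∈ AddSubgroup.closure (A : Set G), x ∈ allSubsetSums A) ∨
      2 * A.card ≤ (allSubsetSums A).card + 1 := by
  induction A using Finset.strongInduction with
  | H A ih =>
  by_contra! hcon
  obtain ⟨⟨z, hz, hzX⟩, hlt⟩ := hcon
  have notfull : ¬ ∀ x ∈ AddSubgroup.closure (A : Set G), x ∈ allSubsetSums A :=
    fun h => hzX (h z hz)
  have hper : ∀ h : G, (∀ x ∈ allSubsetSums A, x + h ∈ allSubsetSums A) → h = 0 := by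
    intro h hh
    by_contra h0
    rcases closure_subset_or_two_mul_card_le_of_period hA0 h0 hh with h | h
    · exact notfull h
    · omega
  have hsub : ∀ a, allSubsetSums (A.erase a) ⊆ allSubsetSums A := fun a =>
    allSubsetSums_mono (erase_subset _ _)
  have hssub : ∀ a ∈ A, (allSubsetSums (A.erase a)).card < (allSubsetSums A).card := by
    intro a ha
    refine card_lt_card ((hsub a).ssubset_of_ne fun e => hA0 ?_)
    rw [← hper a fun x hx => add_mem_of_mem_erase ha (e ▸ hx)]
    exact ha
  have hlow : ∀ a ∈ A, 2 * A.card ≤ (allSubsetSums (A.erase a)).card + 3 := by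
    intro a ha
    rcases ih _ (erase_ssubset ha) (fun h => hA0 (mem_of_mem_erase h)) with hfull | hcard
    · have haK : a ∉ AddSubgroup.closure (A.erase a : Set G) := by
        intro haK
        refine hzX (hsub a (hfull z ((AddSubgroup.closure_le _).2 (fun b hb => ?_) hz)))
        by_cases hba : b = a
        · rwa [hba]
        · exact AddSubgroup.subset_closure (mem_coe.2 (mem_erase.2 ⟨hba, hb⟩))
      have hdisj : Disjoint (allSubsetSums (A.erase a))
          ((allSubsetSums (A.erase a)).image fun x => x + a) := by
        rw [disjoint_left]
        intro u hu hu'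
        obtain ⟨x, hx, rfl⟩ := mem_image.1 hu'
        exact haK ((AddSubgroup.add_mem_cancel_left _ (allSubsetSums_subset_closure _ hx)).1
          (allSubsetSums_subset_closure _ hu))
      have hunion := card_le_card (union_subset (hsub a)
        (image_subset_iff.2 fun x hx => add_mem_of_mem_erase ha hx))
      rw [card_union_of_disjoint hdisj, card_image_of_injective _ (add_left_injective a)] at hunion
      have h0 := card_le_card (insert_subset (zero_mem_allSubsetSums (A.erase a))
        (subset_allSubsetSums (A.erase a)))
      rw [card_insert_of_notMem (fun h => hA0 (mem_of_mem_erase h)), card_erase_of_mem ha] at h0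
      omega
    · rw [card_erase_of_mem ha] at hcard
      omega
  have hv : ∀ a ∈ A, ∃ v ∉ allSubsetSums (A.erase a),
      insert v (allSubsetSums (A.erase a)) = allSubsetSums A := by
    intro a ha
    have h1 := hssub a ha
    have h2 := hlow a ha
    obtain ⟨v, hvX, hv⟩ := exists_mem_notMem_of_card_lt_card h1
    refine ⟨v, hv, eq_of_subset_of_card_le (insert_subset hvX (hsub a)) ?_⟩
    rw [card_insert_of_notMem hv]
    omega
  choose! v hv hins using hv
  have hinsA : (insert 0 A).card ≤ (allSubsetSums A).card :=
    card_le_card (insert_subset (zero_mem_allSubsetSums A) (subset_allSubsetSums A))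
  rw [card_insert_of_notMem hA0] at hinsA
  obtain ⟨p, hp⟩ : A.Nonempty := card_pos.1 (by omega)
  obtain ⟨r, hr, hrp⟩ : ∃ r ∈ A, r ∉ ({p, -p} : Finset G) :=
    exists_mem_notMem_of_card_lt_card (card_le_two.trans_lt (by omega))
  simp only [mem_insert, mem_singleton, not_or] at hrp
  obtain ⟨y, hy, hcl⟩ := exists_insert_eq_closure (v := v) hA0
    (fun a ha => by rw [← hins a ha]; exact mem_insert_self _ _)
    (fun a ha x => by
      rw [← hins a ha]
      refine ⟨fun hx => ⟨mem_insert_of_mem hx, fun e => hv a ha (e ▸ hx)⟩,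
        fun hx => mem_of_mem_insert_of_ne hx.1 hx.2⟩)
    hper hp hr hrp.1 hrp.2
  have hXcard : (allSubsetSums A).card + 2 = 2 * A.card := by
    have h1 := hssub p hp
    have h2 := hlow p hp
    omega
  have hcard : Nat.card (AddSubgroup.closure (A : Set G)) + 1 = 2 * A.card := by
    have : (AddSubgroup.closure (A : Set G) : Set G) = ↑(insert y (allSubsetSums A)) :=
      Set.ext hcl
    rw [← SetLike.coe_sort_coe, this, Nat.card_coe_set_eq, Set.ncard_coe_finset,
      card_insert_of_notMem hy]
    omega
  set C := insert (0 : G) A with hC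
  have hCX : C ⊆ allSubsetSums A :=
    insert_subset (zero_mem_allSubsetSums A) (subset_allSubsetSums A)
  have hCcard : C.card = A.card + 1 := card_insert_of_notMem hA0
  have hycl : y ∈ AddSubgroup.closure (A : Set G) := (hcl y).2 (mem_insert_self _ _)
  have hinter : 1 < (C ∩ C.image fun x => y - x).card := by
    have hunion : C ∪ (C.image fun x => y - x) ⊆ insert y (allSubsetSums A) := by
      refine union_subset (hCX.trans (subset_insert _ _)) fun u hu => ?_
      obtain ⟨x, hx, rfl⟩ := mem_image.1 hu
      exact (hcl _).1 (AddSubgroup.sub_mem _ hycl (allSubsetSums_subset_closure A (hCX hx)))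
    have h1 := card_le_card hunion
    have h2 := card_union_add_card_inter C (C.image fun x => y - x)
    rw [card_image_of_injective _ sub_right_injective] at h2
    rw [card_insert_of_notMem hy] at h1
    omega
  have hhalf : ∀ x ∈ C ∩ C.image fun x => y - x, x ∈ C ∧ x + x = y := by
    intro x hx
    obtain ⟨hxC, hx'⟩ := mem_inter.1 hx
    obtain ⟨w, hw, rfl⟩ := mem_image.1 hx'
    refine ⟨hxC, ?_⟩
    by_contra hne
    have hnew : y - w ≠ w := fun h => hne (by
      nth_rw 2 [h]
      exact sub_add_cancel y w)
    apply hy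
    rw [← sub_add_cancel y w]
    rcases mem_insert.1 hw with rfl | hwA
    · simpa using hCX hxC
    · refine add_mem_of_mem_erase hwA ?_
      rcases mem_insert.1 hxC with h | h
      · rw [h]
        exact zero_mem_allSubsetSums _
      · exact subset_allSubsetSums _ (mem_erase.2 ⟨hnew, h⟩)
  obtain ⟨a, ha, b, hb, hab⟩ := one_lt_card.1 hinter
  obtain ⟨haC, ha⟩ := hhalf a ha
  obtain ⟨hbC, hb⟩ := hhalf b hb
  have hd : a - b ∈ AddSubgroup.closure (A : Set G) := AddSubgroup.sub_mem _
    (allSubsetSums_subset_closure A (hCX haC)) (allSubsetSums_subset_closure A (hCX hbC))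
  have h2 : (2 : ℕ) • (a - b) = 0 := by
    rw [smul_sub, two_nsmul, two_nsmul, ha, hb, sub_self]
  have hord : addOrderOf (a - b) = 2 := addOrderOf_eq_prime h2 (sub_ne_zero.2 hab)
  have hdvd := (AddSubgroup.closure (A : Set G)).addOrderOf_dvd_natCard hd
  rw [hord] at hdvd
  omega

end

theorem stmt11 {G : Type*} [AddCommGroup G] [DecidableEq G]
    (A : Finset G) (hA : A.Nonempty) (hA0 : (0 : G) ∉ A) :
    min (ENat.card (AddSubgroup.closure (A : Set G)))
        ((2 * A.card - 1 : ℕ) : ℕ∞) ≤ ((nss A).card : ℕ∞) := by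
  have hins : insert 0 (nss A) = allSubsetSums A := by
    ext x
    simp only [nss, allSubsetSums, mem_insert, mem_image, mem_erase, mem_powerset]
    constructor
    · rintro (rfl | ⟨B, hB, rfl⟩)
      · exact ⟨∅, by simp, by simp⟩
      · exact ⟨B, hB.2, rfl⟩
    · rintro ⟨B, hB, rfl⟩
      by_cases h : B = ∅
      · simp [h]
      · exact Or.inr ⟨B, ⟨h, hB⟩, rfl⟩
  by_cases h0 : (0 : G) ∈ nss A
  · rw [insert_eq_of_mem h0] at hins
    rw [hins]
    rcases closure_subset_or_two_mul_card_le A hA0 with h | h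
    · refine (min_le_left _ _).trans ?_
      rw [← Set.encard_coe_eq_coe_finsetCard]
      exact Set.encard_le_encard h
    · refine (min_le_right _ _).trans (Nat.cast_le.2 ?_)
      omega
  · refine (min_le_right _ _).trans (Nat.cast_le.2 ?_)
    have h := two_mul_card_le_of_zeroSumFree A hA fun B hB hsum => by
      by_contra hne
      exact h0 (mem_image.2 ⟨B, mem_erase.2 ⟨hne, mem_powerset.2 hB⟩, hsum⟩)
    rw [← hins, card_insert_of_notMem h0] at h
    omega
end

section
/- Let p be a prime number with p ≥ 3 (so that Z_p has order at least 3 when p ≥ 3). For G = Z_p the cyclic group of prime order p ≥ 3, the critical number satisfies cr(G) = ⌊2√(p − 2)⌋. -/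
open Finset

/-- The critical number of a finite abelian group `G`. -/
noncomputable def cr (G : Type*) [AddCommGroup G] [Fintype G] [DecidableEq G] : ℕ :=
  sInf {ℓ : ℕ | 0 < ℓ ∧ ∀ A : Finset G, (0 : G) ∉ A → ℓ ≤ A.card → nss A = Finset.univ}

open MvPolynomial Matrix

/-- The coefficients of the Vandermonde determinant times a power of the sum of the variables. -/
theorem prod_factorial_mul_coeff_det_vandermonde_mul_sum_pow {R : Type*} [CommRing R] [IsDomain R]
    {k : ℕ} (t : Fin k →₀ ℕ) (m : ℕ) (ht : ∑ i, t i = m + ∑ i : Fin k, (i : ℕ)) :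
    ((∏ i, (t i).factorial : ℕ) : R) *
        coeff t ((vandermonde (X : Fin k → MvPolynomial (Fin k) R)).det * (∑ i, X i) ^ m) =
      (m.factorial : R) * (vandermonde fun i => (t i : R)).det := by
  rw [det_eval_matrixOfPolynomials_eq_det_vandermonde (fun i => (t i : R))
    (fun i => descPochhammer R i) (fun i => descPochhammer_natDegree R i)
    (fun i => monic_descPochhammer R i)]
  rw [← det_transpose, ← det_transpose (of _), det_apply', det_apply', Finset.sum_mul, coeff_sum,
    Finset.mul_sum, Finset.mul_sum]
  refine Finset.sum_congr rfl fun σ _ => ?_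
  set s : Fin k →₀ ℕ := Finsupp.equivFunOnFinite.symm fun i => (σ i : ℕ)
  have hsi (i) : s i = σ i := rfl
  have hmon : ((Equiv.Perm.sign σ : ℤ) : MvPolynomial (Fin k) R) *
      ∏ i, (vandermonde (X : Fin k → MvPolynomial (Fin k) R))ᵀ (σ i) i =
      monomial s ((Equiv.Perm.sign σ : ℤ) : R) := by
    rw [monomial_eq, Finsupp.prod_fintype _ _ (by simp)]
    simp [hsi, vandermonde_apply]
  have hdesc : ∏ i, (of fun i j : Fin k => (descPochhammer R j).eval (t i : R))ᵀ (σ i) i =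
      ((∏ i, (t i).descFactorial (s i) : ℕ) : R) := by
    push_cast
    exact Finset.prod_congr rfl fun i _ => by
      simp [hsi, descPochhammer_eval_eq_descFactorial]
  rw [hmon, hdesc, coeff_monomial_mul']
  have hsum : ∑ i, s i = ∑ i : Fin k, (i : ℕ) := Equiv.sum_comp σ (fun i : Fin k => (i : ℕ))
  split_ifs with hst
  · have hdeg : ∑ i, (t - s) i = m := by
      have : ∑ i, (t - s) i + ∑ i, s i = ∑ i, t i := by
        rw [← Finset.sum_add_distrib]
        exact Finset.sum_congr rfl fun i _ => Nat.sub_add_cancel (hst i)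
      omega
    rw [coeff_sum_X_pow_of_fintype, if_pos (by rw [Finsupp.sum_fintype _ _ (by simp), hdeg]),
      Finsupp.multinomial_eq_of_support_subset (Finset.subset_univ _)]
    have hm : (∏ i, (t i).factorial) * Nat.multinomial Finset.univ (t - s : Fin k →₀ ℕ) =
        m.factorial * ∏ i, (t i).descFactorial (s i) := by
      have h : ∏ i, (t i).factorial =
          (∏ i, ((t - s) i).factorial) * ∏ i, (t i).descFactorial (s i) := by
        rw [← Finset.prod_mul_distrib]
        exact Finset.prod_congr rfl fun i _ =>
          (Nat.factorial_mul_descFactorial (hst i)).symm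
      rw [h, mul_right_comm, Nat.multinomial_spec, hdeg]
    have hm' := congrArg (Nat.cast : ℕ → R) hm
    push_cast at hm' ⊢
    linear_combination ((Equiv.Perm.sign σ : ℤ) : R) * hm'
  · obtain ⟨i, hi⟩ : ∃ i, t i < s i := by
      by_contra! h
      exact hst h
    rw [Finset.prod_eq_zero (f := fun i => (t i).descFactorial (s i)) (Finset.mem_univ i) (Nat.descFactorial_eq_zero_iff_lt.2 hi)]
    simp

theorem totalDegree_det_vandermonde_X_le {R : Type*} [CommRing R] [Nontrivial R]
    (k : ℕ) :
    (vandermonde (X : Fin k → MvPolynomial (Fin k) R)).det.totalDegree ≤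
      ∑ i : Fin k, (i : ℕ) := by
  rw [det_apply']
  refine totalDegree_finsetSum_le fun σ _ => (totalDegree_mul _ _).trans ?_
  rw [← map_intCast (C : R →+* MvPolynomial (Fin k) R), totalDegree_C, zero_add]
  refine (totalDegree_finsetProd _ _).trans (Finset.sum_le_sum fun i _ => ?_)
  exact (totalDegree_pow _ _).trans
    (by simp)

/-- Strictly increasing `k`-tuples below `N` realise every sum between the extreme ones. -/
theorem exists_injective_lt_sum_eq {k N m : ℕ} (h : m ≤ k * (N - k)) (hm : 0 < m) :
    ∃ t : Fin k → ℕ, Function.Injective t ∧ (∀ i, t i < N) ∧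
      ∑ i, t i = m + ∑ i : Fin k, (i : ℕ) := by
  have hk : 0 < k := Nat.pos_of_ne_zero (by rintro rfl; omega)
  have hr : m % k < k := Nat.mod_lt _ hk
  have hdm : k * (m / k) + m % k = m := Nat.div_add_mod m k
  have hq : m / k ≤ N - k := Nat.div_le_of_le_mul h
  have hq' : 0 < m % k → m / k < N - k := fun h0 => by
    refine lt_of_le_of_ne hq fun he => ?_
    rw [he] at hdm
    omega
  have hNk : 0 < N - k := Nat.pos_of_ne_zero (by intro h0; simp [h0] at h; omega)
  refine ⟨fun i => i + m / k + if k - m % k ≤ i then 1 else 0, ?_, ?_, ?_⟩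
  · refine StrictMono.injective fun i j hij => ?_
    have : (i : ℕ) < j := hij
    split_ifs <;> omega
  · intro i
    have := i.2
    dsimp only
    split_ifs with hi
    · have := hq' (by omega)
      omega
    · omega
  · have hcard : ∑ i : Fin k, (if k - m % k ≤ (i : ℕ) then 1 else 0) = m % k := by
      rw [Fin.sum_univ_eq_sum_range (fun i => if k - m % k ≤ i then 1 else 0) k,
        Finset.sum_boole]
      have : (Finset.range k).filter (fun i => k - m % k ≤ i) = Finset.Ico (k - m % k) k := by
        ext i
        simp [and_comm]
      rw [this]
      simp
      omega
    simp only [Finset.sum_add_distrib, hcard, Finset.sum_const, Finset.card_univ,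
      Fintype.card_fin, smul_eq_mul]
    omega

/-- The case of full coverage in the Dias da Silva–Hamidoune theorem. -/
theorem exists_subset_card_eq_sum_eq {p : ℕ} [hp : Fact p.Prime] (A : Finset (ZMod p)) {k : ℕ}
    (hk : p - 1 ≤ k * (#A - k)) (c : ZMod p) : ∃ B ⊆ A, #B = k ∧ ∑ x ∈ B, x = c := by
  have hp1 := hp.out.one_lt
  obtain ⟨t, ht_inj, ht_lt, ht_sum⟩ := exists_injective_lt_sum_eq hk (by omega)
  have htp (i) : t i < p := (ht_lt i).trans_le (by simpa [ZMod.card] using Finset.card_le_univ A)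
  set T : Fin k →₀ ℕ := Finsupp.equivFunOnFinite.symm t
  have hTi (i) : T i = t i := rfl
  have hTdeg : T.degree = p - 1 + ∑ i : Fin k, (i : ℕ) := by
    rw [Finsupp.degree_eq_sum, ← ht_sum]
    rfl
  set V := (vandermonde (X : Fin k → MvPolynomial (Fin k) (ZMod p))).det
  set S : MvPolynomial (Fin k) (ZMod p) := ∑ i, X i
  have hS : S.totalDegree ≤ 1 := totalDegree_finsetSum_le fun i _ => by simp
  have hSc : (S - C c).totalDegree ≤ 1 := (totalDegree_sub_C_le _ _).trans hS
  have hrest : ((S - C c) ^ (p - 1) - 1 - S ^ (p - 1)).totalDegree ≤ p - 2 := by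
    rw [sub_right_comm, ← (Commute.all (S - C c) S).mul_geom_sum₂, ← C_1]
    refine (totalDegree_sub_C_le _ _).trans ((totalDegree_mul _ _).trans ?_)
    rw [sub_sub_cancel_left, totalDegree_neg, totalDegree_C, zero_add]
    refine totalDegree_finsetSum_le fun i hi => (totalDegree_mul _ _).trans ?_
    have h1 := (totalDegree_pow (S - C c) i).trans (Nat.mul_le_mul_left i hSc)
    have h2 := (totalDegree_pow S (p - 1 - 1 - i)).trans (Nat.mul_le_mul_left _ hS)
    have := Finset.mem_range.1 hi
    omega
  have hfac {n : ℕ} (hn : n < p) : (n.factorial : ZMod p) ≠ 0 := by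
    rw [Ne, ZMod.natCast_eq_zero_iff, hp.out.dvd_factorial]
    omega
  have hmain : coeff T (V * S ^ (p - 1)) ≠ 0 := by
    have h := prod_factorial_mul_coeff_det_vandermonde_mul_sum_pow (R := ZMod p) T (p - 1) ht_sum
    refine right_ne_zero_of_mul (a := ((∏ i, (T i).factorial : ℕ) : ZMod p)) ?_
    rw [h]
    refine mul_ne_zero (hfac (by omega)) (det_vandermonde_ne_zero_iff.2 fun i j hij => ?_)
    refine ht_inj ?_
    have := (ZMod.natCast_eq_natCast_iff' _ _ _).1 hij
    rwa [hTi, hTi, Nat.mod_eq_of_lt (htp i), Nat.mod_eq_of_lt (htp j)] at this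
  have hV : V.totalDegree ≤ ∑ i : Fin k, (i : ℕ) := totalDegree_det_vandermonde_X_le k
  have hcoeff : coeff T (V * ((S - C c) ^ (p - 1) - 1)) ≠ 0 := by
    have hz : coeff T (V * ((S - C c) ^ (p - 1) - 1 - S ^ (p - 1))) = 0 := by
      refine coeff_eq_zero_of_totalDegree_lt ?_
      rw [← Finsupp.degree_apply, hTdeg]
      have := totalDegree_mul V ((S - C c) ^ (p - 1) - 1 - S ^ (p - 1))
      omega
    rw [mul_sub, coeff_sub, sub_eq_zero] at hz
    rwa [hz]
  have hdeg : (V * ((S - C c) ^ (p - 1) - 1)).totalDegree = T.degree := by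
    refine le_antisymm ?_ ?_
    · rw [hTdeg, ← C_1]
      have h1 := totalDegree_mul V ((S - C c) ^ (p - 1) - C 1)
      have h2 := totalDegree_sub_C_le ((S - C c) ^ (p - 1)) 1
      have h3 := (totalDegree_pow (S - C c) (p - 1)).trans (Nat.mul_le_mul_left _ hSc)
      omega
    · rw [Finsupp.degree_apply]
      exact le_totalDegree (mem_support_iff.2 hcoeff)
  obtain ⟨x, hxA, hx⟩ := combinatorial_nullstellensatz_exists_eval_nonzero _ T hcoeff hdeg
    (fun _ => A) ht_lt
  rw [map_mul] at hx
  have hxinj : Function.Injective x := by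
    have h := left_ne_zero_of_mul hx
    rw [RingHom.map_det] at h
    refine det_vandermonde_ne_zero_iff.1 ?_
    convert h using 2
    ext i j
    simp [vandermonde_apply]
  refine ⟨Finset.univ.image x, by simpa [Finset.image_subset_iff] using hxA, ?_, ?_⟩
  · rw [Finset.card_image_of_injective _ hxinj, Finset.card_univ, Fintype.card_fin]
  · rw [Finset.sum_image hxinj.injOn]
    by_contra hne
    refine right_ne_zero_of_mul hx ?_
    have : (∑ i, x i - c) ^ (p - 1) = 1 := ZMod.pow_card_sub_one_eq_one (sub_ne_zero.2 hne)
    simpa [S, sub_eq_zero] using this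

theorem two_mul_sum_le_of_forall_le (b : ℕ) (s : Finset ℤ) (hs : ∀ x ∈ s, x ≤ b) :
    2 * ∑ x ∈ s, x ≤ b * (b + 1) := by
  induction b generalizing s with
  | zero =>
    have := Finset.sum_nonpos (s := s) (f := fun x => x) (by simpa using hs)
    push_cast
    linarith
  | succ b ih =>
    have h := ih (s.erase (b + 1 : ℕ)) fun x hx => by
      have h1 := hs x (Finset.mem_of_mem_erase hx)
      have h2 := Finset.ne_of_mem_erase hx
      push_cast at h1 h2
      omega
    by_cases hb : ((b + 1 : ℕ) : ℤ) ∈ s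
    · rw [← Finset.add_sum_erase s (fun x => x) hb]
      push_cast at h ⊢
      linarith
    · rw [Finset.erase_eq_of_notMem hb] at h
      push_cast
      linarith

/-- The nonzero integers between `-a` and `b` do not span when their sums do not wrap around. -/
theorem exists_card_eq_nss_ne_univ {p a b : ℕ} [NeZero p]
    (h : a * (a + 1) + b * (b + 1) + 2 < 2 * p) :
    ∃ A : Finset (ZMod p), 0 ∉ A ∧ #A = a + b ∧ nss A ≠ Finset.univ := by
  have hab : a + b < p := by
    have h2 (n : ℕ) : 2 * n ≤ n * (n + 1) := by nlinarith [Nat.le_mul_self n]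
    linarith [h2 a, h2 b]
  set I : Finset ℤ := (Finset.Icc (-a : ℤ) b).erase 0 with hI
  have hmem {x : ℤ} (hx : x ∈ I) : x ≠ 0 ∧ -a ≤ x ∧ x ≤ b := by simpa [hI] using hx
  have hzero {z : ℤ} (hz : (z : ZMod p) = 0) (h1 : -p < z) (h2 : z < p) : z = 0 :=
    Int.eq_zero_of_abs_lt_dvd ((ZMod.intCast_zmod_eq_zero_iff_dvd z p).1 hz) (abs_lt.2 ⟨h1, h2⟩)
  have hinj : Set.InjOn (Int.cast : ℤ → ZMod p) I := fun x hx y hy hxy => by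
    have h1 := hmem hx
    have h2 := hmem hy
    have := hzero (z := x - y) (by simp [hxy]) (by omega) (by omega)
    omega
  refine ⟨I.image Int.cast, ?_, ?_, fun hspan => ?_⟩
  · rw [Finset.mem_image]
    rintro ⟨x, hx, hx0⟩
    have h1 := hmem hx
    exact h1.1 (hzero hx0 (by omega) (by omega))
  · rw [Finset.card_image_of_injOn hinj, hI, Finset.card_erase_of_mem (by simp), Int.card_Icc]
    omega
  · obtain ⟨T, hT⟩ := even_iff_two_dvd.1 (Int.even_mul_succ_self (b : ℤ))
    have hx := Finset.mem_univ ((T + 1 : ℤ) : ZMod p)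
    rw [← hspan, nss, Finset.mem_image] at hx
    obtain ⟨B, hB, hsum⟩ := hx
    obtain ⟨B', hB', rfl⟩ := Finset.subset_image_iff.1
      (Finset.mem_powerset.1 (Finset.mem_of_mem_erase hB))
    rw [Finset.sum_image (hinj.mono hB')] at hsum
    have hup := two_mul_sum_le_of_forall_le b B' fun x hx => (hmem (hB' hx)).2.2
    have hlo := two_mul_sum_le_of_forall_le a (B'.image Neg.neg) fun x hx => by
      obtain ⟨y, hy, rfl⟩ := Finset.mem_image.1 hx
      have := hmem (hB' hy)
      omega
    rw [Finset.sum_image neg_injective.injOn, Finset.sum_neg_distrib] at hlo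
    have hsum' : ((T + 1 - ∑ x ∈ B', x : ℤ) : ZMod p) = 0 := by
      rw [Int.cast_sub, ← hsum]
      simp
    zify at h
    have := hzero hsum' (by linarith) (by linarith)
    linarith

theorem nss_eq_univ_of_sqrt_le_card {p : ℕ} [hp : Fact p.Prime] (h3 : 3 ≤ p)
    {A : Finset (ZMod p)} (hA : 0 ∉ A) (hcard : Nat.sqrt (4 * (p - 2)) ≤ #A) :
    nss A = Finset.univ := by
  have hodd : p % 2 = 1 := (hp.out.eq_two_or_odd).resolve_left (by omega)
  have hlt : 4 * (p - 2) < (#A + 1) * (#A + 1) := Nat.sqrt_lt.1 (by omega)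
  have hcard2 : 2 ≤ #A := le_trans (Nat.le_sqrt.2 (by omega)) hcard
  obtain ⟨k, hk2, hk⟩ : ∃ k, 2 ≤ k ∧ p - 1 ≤ k * (#A + 1 - k) := by
    obtain ⟨j, hj | hj⟩ := Nat.even_or_odd' #A
    · refine ⟨j + 1, by omega, ?_⟩
      rw [show #A + 1 - (j + 1) = j by omega]
      rw [hj] at hlt
      have h1 : p - 2 ≤ (j + 1) * j := by
        by_contra! hc
        nlinarith
      have h2 : (j + 1) * j % 2 = 0 := by
        rw [mul_comm]; exact Nat.even_iff.1 (Nat.even_mul_succ_self j)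
      omega
    · refine ⟨j + 1, by omega, ?_⟩
      rw [show #A + 1 - (j + 1) = j + 1 by omega]
      rw [hj] at hlt
      have h1 : p - 2 < (j + 1) * (j + 1) := by
        by_contra! hc
        nlinarith
      omega
  refine Finset.eq_univ_of_forall fun c => ?_
  obtain ⟨B, hB, hBk, hBc⟩ := exists_subset_card_eq_sum_eq (insert 0 A) (k := k)
    (by rwa [Finset.card_insert_of_notMem hA]) c
  rw [nss, Finset.mem_image]
  refine ⟨B.erase 0, ?_, ?_⟩
  · rw [Finset.mem_erase, Finset.mem_powerset, Ne, Finset.erase_eq_empty_iff]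
    refine ⟨?_, Finset.subset_insert_iff.1 hB⟩
    rintro (rfl | rfl) <;> simp at hBk <;> omega
  · rw [← hBc]
    exact Finset.sum_erase _ rfl

theorem stmt17 {p : ℕ} [hp : Fact p.Prime] (h3 : 3 ≤ p) :
    cr (ZMod p) = Nat.sqrt (4 * (p - 2)) := by
  have hn2 : 2 ≤ Nat.sqrt (4 * (p - 2)) := Nat.le_sqrt.2 (by omega)
  refine IsLeast.csInf_eq ⟨⟨by omega, fun A hA hcard => nss_eq_univ_of_sqrt_le_card h3 hA hcard⟩,
    fun l hl => ?_⟩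
  by_contra! hlt
  have hsq : Nat.sqrt (4 * (p - 2)) * Nat.sqrt (4 * (p - 2)) ≤ 4 * (p - 2) := Nat.sqrt_le _
  obtain ⟨a, b, hab, h⟩ : ∃ a b, a + b = Nat.sqrt (4 * (p - 2)) - 1 ∧
      a * (a + 1) + b * (b + 1) + 2 < 2 * p := by
    obtain ⟨j, hj | hj⟩ := Nat.even_or_odd' (Nat.sqrt (4 * (p - 2)))
    · obtain ⟨i, rfl⟩ : ∃ i, j = i + 1 := ⟨j - 1, by omega⟩
      refine ⟨i, i + 1, by omega, ?_⟩
      rw [hj] at hsq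
      have : (i + 1) * (i + 1) ≤ p - 2 := by nlinarith
      have : (i + 1) * (i + 1) + 2 ≤ p := by omega
      nlinarith
    · refine ⟨j, j, by omega, ?_⟩
      rw [hj] at hsq
      have : j * (j + 1) ≤ p - 2 := by nlinarith
      omega
  obtain ⟨A, hA0, hAcard, hA⟩ := exists_card_eq_nss_ne_univ h
  exact hA (hl.2 A hA0 (by omega))
end

section
/- Let G be a finite abelian group of order |G| ≥ 3 and let p denote the smallest prime divisor of |G|. If |G|/p is an odd prime with 2 < p < |G|/p ≤ p + ⌊2√(p − 2)⌋ + 1, then cr(G) = |G|/p + p − 1. -/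
open Finset

/-- The sums of the `j`-element subsets of `X`. -/
def levelSums {M : Type*} [AddCommMonoid M] [DecidableEq M] (X : Finset M) (j : ℕ) : Finset M :=
  (X.powersetCard j).image fun B => ∑ y ∈ B, y

lemma mem_levelSums {M : Type*} [AddCommMonoid M] [DecidableEq M] {X : Finset M} {j : ℕ} {s : M} :
    s ∈ levelSums X j ↔ ∃ B ⊆ X, #B = j ∧ ∑ y ∈ B, y = s := by
  simp [levelSums, mem_powersetCard, and_assoc]

lemma levelSums_nonempty {M : Type*} [AddCommMonoid M] [DecidableEq M] {X : Finset M} {j : ℕ}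
    (h : j ≤ #X) : (levelSums X j).Nonempty :=
  (powersetCard_nonempty.2 h).image _

lemma card_le_card_levelSums_one {M : Type*} [AddCommMonoid M] [DecidableEq M] (X : Finset M) :
    #X ≤ #(levelSums X 1) :=
  card_le_card fun x hx => mem_levelSums.2 ⟨{x}, by simpa using hx, by simp, by simp⟩

lemma add_mem_levelSums_two {M : Type*} [AddCommMonoid M] [DecidableEq M] {X : Finset M} {x y : M}
    (hx : x ∈ X) (hy : y ∈ X) (h : x ≠ y) : x + y ∈ levelSums X 2 :=
  mem_levelSums.2 ⟨{x, y}, by simp [insert_subset_iff, hx, hy], card_pair h, sum_pair h⟩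

lemma card_levelSums_le_card_levelSums_sub {M : Type*} [AddCommGroup M] [DecidableEq M]
    {X : Finset M} {j : ℕ} : #(levelSums X j) ≤ #(levelSums X (#X - j)) := by
  refine card_le_card_of_injOn (fun s => ∑ y ∈ X, y - s) ?_ (fun a _ b _ h => by simpa using h)
  intro s hs
  obtain ⟨B, hB, hj, rfl⟩ := mem_levelSums.1 hs
  refine mem_levelSums.2 ⟨X \ B, sdiff_subset, by rw [card_sdiff_of_subset hB, hj], ?_⟩
  rw [eq_sub_iff_add_eq, sum_sdiff hB]

open scoped Pointwise in
lemma levelSums_add_subset {M : Type*} [AddCommMonoid M] [DecidableEq M] {X Y : Finset M}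
    (h : Disjoint X Y) (i j : ℕ) :
    levelSums X i + levelSums Y j ⊆ levelSums (X ∪ Y) (i + j) := by
  intro s hs
  obtain ⟨a, ha, b, hb, rfl⟩ := mem_add.1 hs
  obtain ⟨B, hB, hi, rfl⟩ := mem_levelSums.1 ha
  obtain ⟨C, hC, hj, rfl⟩ := mem_levelSums.1 hb
  have hBC := disjoint_of_subset_left hB (disjoint_of_subset_right hC h)
  exact mem_levelSums.2 ⟨B ∪ C, union_subset_union hB hC, by rw [card_union_of_disjoint hBC, hi, hj],
    sum_union hBC⟩

lemma card_le_card_levelSums_two {q : ℕ} [Fact q.Prime] {X : Finset (ZMod q)} (hX : 3 ≤ #X) :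
    #X ≤ #(levelSums X 2) := by
  by_contra! hlt
  have hXq : #X ≤ q := by simpa using card_le_univ X
  have key (x) (hx : x ∈ X) :
      ∑ s ∈ levelSums X 2, s = ((#X - 2 : ℕ) : ZMod q) * x + ∑ y ∈ X, y := by
    have heq : (X.erase x).image (x + ·) = levelSums X 2 := by
      refine eq_of_subset_of_card_le ?_ ?_
      · intro s hs
        obtain ⟨y, hy, rfl⟩ := mem_image.1 hs
        exact add_mem_levelSums_two hx (mem_of_mem_erase hy) (ne_of_mem_erase hy).symm
      · rw [card_image_of_injective _ (add_right_injective x), card_erase_of_mem hx]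
        omega
    rw [← heq, sum_image (fun a _ b _ h => by simpa using h), sum_add_distrib, sum_const,
      card_erase_of_mem hx, ← add_sum_erase X _ hx, nsmul_eq_mul,
      show #X - 1 = (#X - 2) + 1 by omega]
    push_cast
    ring
  obtain ⟨x, hx, y, hy, hxy⟩ := one_lt_card.1 (show 1 < #X by omega)
  have h := (key x hx).symm.trans (key y hy)
  have h0 : ((#X - 2 : ℕ) : ZMod q) * (x - y) = 0 := by linear_combination h
  rcases mul_eq_zero.1 h0 with h0 | h0
  · rw [ZMod.natCast_eq_zero_iff] at h0
    have := Nat.le_of_dvd (by omega) h0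
    have := (Fact.out : q.Prime).pos
    omega
  · exact hxy (sub_eq_zero.1 h0)

lemma five_le_card_levelSums_two {M : Type*} [AddCommGroup M] [DecidableEq M]
    (cancel : ∀ x y : M, x + x = y + y → x = y) {X : Finset M} (hX : #X = 4) :
    5 ≤ #(levelSums X 2) := by
  obtain ⟨a, b, c, d, hab, hac, had, hbc, hbd, hcd, rfl⟩ := card_eq_four.1 hX
  have five (s₁ s₂ s₃ s₄ s₅ : M) (S : Finset M) (hS : {s₁, s₂, s₃, s₄, s₅} ⊆ S)
      (h : s₁ ∉ ({s₂, s₃, s₄, s₅} : Finset M)) (h' : s₂ ∉ ({s₃, s₄, s₅} : Finset M))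
      (h'' : s₃ ∉ ({s₄, s₅} : Finset M)) (h''' : s₄ ∉ ({s₅} : Finset M)) :
      5 ≤ #S := by
    refine le_trans (le_of_eq ?_) (card_le_card hS)
    rw [card_insert_of_notMem h, card_insert_of_notMem h', card_insert_of_notMem h'',
      card_insert_of_notMem h''', card_singleton]
  have mab := add_mem_levelSums_two (X := {a, b, c, d}) (by simp) (by simp) hab
  have mac := add_mem_levelSums_two (X := {a, b, c, d}) (by simp) (by simp) hac
  have mad := add_mem_levelSums_two (X := {a, b, c, d}) (by simp) (by simp) had
  have mbc := add_mem_levelSums_two (X := {a, b, c, d}) (by simp) (by simp) hbc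
  have mbd := add_mem_levelSums_two (X := {a, b, c, d}) (by simp) (by simp) hbd
  have mcd := add_mem_levelSums_two (X := {a, b, c, d}) (by simp) (by simp) hcd
  by_cases h1 : a + b = c + d
  · have h3 : a + c ≠ b + d := fun h => hbc (cancel _ _ (by grind only))
    have h4 : a + d ≠ b + c := fun h => hbd (cancel _ _ (by grind only))
    refine five (a + b) (a + c) (b + d) (a + d) (b + c) _ ?_ ?_ ?_ ?_ ?_ <;>
      simp only [insert_subset_iff, singleton_subset_iff, mem_insert, mem_singleton] <;>
      clear five cancel hX <;> grind
  · by_cases h3 : a + c = b + d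
    · have h4 : a + d ≠ b + c := fun h => hcd (cancel _ _ (by grind only))
      refine five (a + b) (c + d) (a + c) (a + d) (b + c) _ ?_ ?_ ?_ ?_ ?_ <;>
        simp only [insert_subset_iff, singleton_subset_iff, mem_insert, mem_singleton] <;>
      clear five cancel hX <;> grind
    · refine five (a + b) (c + d) (a + c) (b + d) (a + d) _ ?_ ?_ ?_ ?_ ?_ <;>
        simp only [insert_subset_iff, singleton_subset_iff, mem_insert, mem_singleton] <;>
      clear five cancel hX <;> grind

lemma card_le_card_levelSums {q : ℕ} [Fact q.Prime] (hq : 2 < q) (X : Finset (ZMod q)) (j : ℕ)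
    (hj : 1 ≤ j) (hjX : j + 1 ≤ #X) : #X ≤ #(levelSums X j) := by
  have h2 : (2 : ZMod q) ≠ 0 := by
    intro h
    have := Nat.le_of_dvd two_pos ((ZMod.natCast_eq_zero_iff 2 q).1 (by exact_mod_cast h))
    omega
  have hcancel (x y : ZMod q) (h : x + x = y + y) : x = y :=
    mul_left_cancel₀ h2 (by linear_combination h)
  obtain ⟨a, ha⟩ : ∃ a, #X = a := ⟨_, rfl⟩
  induction a using Nat.strong_induction_on generalizing X j with
  | _ a ih =>
    rcases (show j = 1 ∨ j = #X - 1 ∨ j = 2 ∨ j = #X - 2 ∨ (3 ≤ j ∧ j + 3 ≤ #X) by omega) with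
      rfl | rfl | rfl | rfl | ⟨h3, h3'⟩
    · exact card_le_card_levelSums_one X
    · exact (card_le_card_levelSums_one X).trans card_levelSums_le_card_levelSums_sub
    · exact card_le_card_levelSums_two hjX
    · exact (card_le_card_levelSums_two (by omega)).trans card_levelSums_le_card_levelSums_sub
    · obtain ⟨Y, hYX, hY⟩ := exists_subset_card_eq (show 4 ≤ #X by omega)
      have hZ : #(X \ Y) = #X - 4 := by rw [card_sdiff_of_subset hYX, hY]
      have hsub := levelSums_add_subset (disjoint_sdiff (s := Y) (t := X)) 2 (j - 2)
      rw [union_sdiff_of_subset hYX, show 2 + (j - 2) = j by omega] at hsub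
      have h4 := five_le_card_levelSums_two hcancel hY
      have h5 := ih (a - 4) (by omega) (X \ Y) (j - 2) (by omega) (by omega) (by omega)
      have hXq : #X ≤ q := by simpa using card_le_univ X
      have hcd := ZMod.cauchy_davenport (Fact.out : q.Prime)
        (levelSums_nonempty (X := Y) (j := 2) (by omega))
        (levelSums_nonempty (X := X \ Y) (j := j - 2) (by omega))
      have := card_le_card hsub
      omega

/-- An iterated Cauchy-Davenport inequality. -/
lemma exists_sums_of_cauchy_davenport {ι : Type*} {p : ℕ} [Fact p.Prime]
    (s : Finset ι) (F : ι → Finset (ZMod p)) (k : ι → ℕ) (h : ∀ i ∈ s, min p (k i + 1) ≤ #(F i)) :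
    ∃ W : Finset (ZMod p), min p (∑ i ∈ s, k i + 1) ≤ #W ∧
      ∀ w ∈ W, ∃ g : ι → ZMod p, (∀ i ∈ s, g i ∈ F i) ∧ ∑ i ∈ s, g i = w := by
  classical
  have hp := (Fact.out : p.Prime)
  induction s using Finset.induction_on with
  | empty => exact ⟨{0}, by simp, fun w hw => ⟨0, by simp, by simp_all⟩⟩
  | insert a s ha ih =>
    obtain ⟨W, hW, hg⟩ := ih fun i hi => h i (mem_insert_of_mem hi)
    have hFa := h a (mem_insert_self _ _)
    have hpos := hp.pos
    open scoped Pointwise in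
    refine ⟨F a + W, ?_, fun w hw => ?_⟩
    · have := ZMod.cauchy_davenport hp (card_pos.1 (show 0 < #(F a) by omega))
        (card_pos.1 (show 0 < #W by omega))
      rw [sum_insert ha]
      omega
    · obtain ⟨x, hx, y, hy, rfl⟩ := mem_add.1 hw
      obtain ⟨g, hgF, rfl⟩ := hg y hy
      refine ⟨Function.update g a x, fun i hi => ?_, ?_⟩
      · rcases eq_or_ne i a with rfl | hia
        · simpa using hx
        · simpa [hia] using hgF i ((mem_insert.1 hi).resolve_left hia)
      · rw [sum_insert ha, Function.update_self]
        congr 1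
        exact sum_congr rfl fun i hi => Function.update_of_ne (ne_of_mem_of_not_mem hi ha) _ _

lemma min_le_card_image_range_nsmul {p : ℕ} [Fact p.Prime] {x : ZMod p} (hx : x ≠ 0) (l k : ℕ) :
    min p k ≤ #((range k).image fun i => (l + i) • x) := by
  have hinj : Set.InjOn (fun i => (l + i) • x) (range (min p k)) := by
    intro i hi i' hi' h
    simp only [coe_range, Set.mem_Iio, lt_min_iff] at hi hi'
    simp only [nsmul_eq_mul] at h
    have h1 : (i : ZMod p) = i' := by
      have := mul_right_cancel₀ hx h
      push_cast at this
      exact add_left_cancel this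
    exact ((ZMod.natCast_eq_natCast_iff i i' p).1 h1).eq_of_lt_of_lt hi.1 hi'.1
  calc min p k = #((range (min p k)).image fun i => (l + i) • x) := by
        rw [card_image_of_injOn hinj, card_range]
    _ ≤ _ := card_le_card (image_subset_image (range_subset_range.2 (min_le_right _ _)))

open scoped Pointwise in
/-- The sizes `j x` of the parts taken from the fibres can be chosen to realise any first coordinate.
From a fibre over `T` a proper nonempty part is taken, and all but at most one of the fibres over `R`
contribute a single element. -/
lemma exists_part_sizes {p : ℕ} [Fact p.Prime] (a : ZMod p → ℕ) (T R : Finset (ZMod p))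
    (hTR : Disjoint T R) (hT0 : 0 ∉ T) (hR0 : 0 ∉ R) (hT : ∀ x ∈ T, 2 ≤ a x)
    (hR : ∀ x ∈ R, a x = 2) (hmove : p + a 0 + 2 * #T + #R ≤ ∑ x, a x + 1) (c : ZMod p) :
    ∃ (j : ZMod p → ℕ) (r : ZMod p), ∑ x, j x • x = c ∧ (∀ x ≠ 0, j x ≤ a x) ∧
      (∀ x ∈ T, 1 ≤ j x ∧ j x + 1 ≤ a x) ∧ (∀ x ∈ R, 1 ≤ j x) ∧ ∀ x ∈ R, x ≠ r → j x = 1 := by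
  have hp := (Fact.out : p.Prime)
  set k : ZMod p → ℕ := fun x =>
    if x = 0 then 0 else if x ∈ T then a x - 2 else if x ∈ R then 0 else a x with hk
  set l : ZMod p → ℕ := fun x => if x ∈ T ∪ R then 1 else 0 with hl
  have hdisj : ∀ x ∈ T, x ∉ R := fun x h h' => disjoint_left.1 hTR h h'
  have hsum : ∑ x, a x = ∑ x, k x + a 0 + 2 * #T + 2 * #R := by
    have hpt (x) : a x = k x + (if x = 0 then a 0 else 0) + (if x ∈ T then 2 else 0) +
        (if x ∈ R then 2 else 0) := by
      have h1 := hT x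
      have h2 := hR x
      have h3 := hdisj x
      simp only [hk]
      grind
    rw [sum_congr rfl fun x _ => hpt x]
    simp [sum_add_distrib, mul_comm]
  obtain ⟨W, hW, hWg⟩ := exists_sums_of_cauchy_davenport (p := p) univ
    (fun x => (range (k x + 1)).image fun i => (l x + i) • x) k (fun x _ => by
      rcases eq_or_ne x 0 with rfl | hx
      · simp [hk]
      · exact min_le_card_image_range_nsmul hx _ _)
  have hfull : W + insert 0 R = univ := by
    rw [← card_eq_iff_eq_univ]
    refine le_antisymm (card_le_univ _) ?_
    have hpos := hp.pos
    have := ZMod.cauchy_davenport hp (card_pos.1 (show 0 < #W by omega)) (insert_nonempty 0 R)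
    rw [card_insert_of_notMem hR0] at this
    rw [ZMod.card]
    omega
  obtain ⟨w, hw, r, hr, hwr⟩ := mem_add.1 (hfull ▸ mem_univ c)
  obtain ⟨g, hg, rfl⟩ := hWg w hw
  have hi (x) : ∃ i, i ≤ k x ∧ (l x + i) • x = g x := by
    obtain ⟨i, hi, h⟩ := mem_image.1 (hg x (mem_univ x))
    exact ⟨i, by simpa [Nat.lt_succ_iff] using hi, h⟩
  choose i hik hig using hi
  refine ⟨fun x => l x + i x + if x = r ∧ x ∈ R then 1 else 0, r, ?_, ?_, ?_, ?_, ?_⟩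
  · have hr' : ∑ x, (if x = r ∧ x ∈ R then 1 else 0) • x = r := by
      rw [sum_eq_single r (fun x _ hx => by simp [hx]) (by simp)]
      rcases mem_insert.1 hr with rfl | hr
      · simp
      · simp [hr]
    simp only [add_nsmul _ (l _ + i _), hig, sum_add_distrib, hr', hwr]
  all_goals
    intro x hx
    have h1 := hT x
    have h2 := hR x
    have h3 := hdisj x
    have h4 := hik x
    simp only [hk] at h4
    simp only [hl, mem_union]
    grind

lemma exists_parts {p q : ℕ} [Fact p.Prime] [Fact q.Prime] (hq : 2 < q)
    (F : ZMod p → Finset (ZMod q)) (h0 : 0 ∉ F 0) (T R : Finset (ZMod p))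
    (hTR : Disjoint T R) (hT0 : 0 ∉ T) (hR0 : 0 ∉ R) (hT : ∀ x ∈ T, 2 ≤ #(F x))
    (hR : ∀ x ∈ R, #(F x) = 2) (hfill : q + #T ≤ #(F 0) + ∑ x ∈ T, #(F x) + (#R - 1) + 1)
    (hmove : p + #(F 0) + 2 * #T + #R ≤ ∑ x, #(F x) + 1) (c : ZMod p) (d : ZMod q) :
    ∃ B : ZMod p → Finset (ZMod q), (∀ x, B x ⊆ F x) ∧ (∀ x ∈ T ∪ R, (B x).Nonempty) ∧
      ∑ x, #(B x) • x = c ∧ ∑ x, ∑ y ∈ B x, y = d := by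
  obtain ⟨j, r, hc, hja, hjT, hjR, hjr⟩ :=
    exists_part_sizes (fun x => #(F x)) T R hTR hT0 hR0 hT hR hmove c
  have hdisj : ∀ x ∈ T, x ∉ R := fun x h h' => disjoint_left.1 hTR h h'
  set k : ZMod p → ℕ := fun x =>
    if x = 0 then #(F 0) else if x ∈ T then #(F x) - 1 else if x ∈ R.erase r then 1 else 0 with hk
  have hsum : ∑ x, k x + #T = #(F 0) + ∑ x ∈ T, #(F x) + #(R.erase r) := by
    have hpt (x) : k x + (if x ∈ T then 1 else 0) = (if x = 0 then #(F 0) else 0) +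
        (if x ∈ T then #(F x) else 0) + (if x ∈ R.erase r then 1 else 0) := by
      have h1 := hT x
      have h3 := hdisj x
      simp only [hk]
      grind
    have := sum_congr (rfl : (univ : Finset (ZMod p)) = univ) fun x _ => hpt x
    simpa [sum_add_distrib, -mem_erase] using this
  obtain ⟨W, hW, hWg⟩ := exists_sums_of_cauchy_davenport (p := q) univ
    (fun x => if x = 0 then insert 0 (F 0) else levelSums (F x) (j x)) k (fun x _ => by
      refine (min_le_right _ _).trans ?_
      simp only [hk]
      split_ifs with hx hxT hxR
      · rw [card_insert_of_notMem h0]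
      · have := card_le_card_levelSums hq (F x) (j x) (hjT x hxT).1 (hjT x hxT).2
        have := hT x hxT
        omega
      · rw [hjr x (mem_of_mem_erase hxR) (ne_of_mem_erase hxR)]
        have := card_le_card_levelSums_one (F x)
        rw [hR x (mem_of_mem_erase hxR)] at this
        exact this
      · exact card_pos.2 (levelSums_nonempty (hja x hx)))
  have hfull : W = univ := by
    rw [← card_eq_iff_eq_univ]
    refine le_antisymm (card_le_univ _) ?_
    have := pred_card_le_card_erase (s := R) (a := r)
    rw [ZMod.card]
    omega
  obtain ⟨g, hg, hgd⟩ := hWg d (hfull ▸ mem_univ d)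
  have hB (x) : ∃ B ⊆ F x, ∑ y ∈ B, y = g x ∧ (x ≠ 0 → #B = j x) := by
    have hgx := hg x (mem_univ x)
    split_ifs at hgx with hx
    · subst hx
      rcases mem_insert.1 hgx with h | h
      · exact ⟨∅, by simp, by simp [h], by simp⟩
      · exact ⟨{g 0}, by simpa using h, by simp, by simp⟩
    · obtain ⟨B, hB, hj, hs⟩ := mem_levelSums.1 hgx
      exact ⟨B, hB, hs, fun _ => hj⟩
  choose B hBF hBg hBj using hB
  refine ⟨B, hBF, fun x hx => ?_, ?_, ?_⟩
  · have hx0 : x ≠ 0 := by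
      rintro rfl
      simp_all
    rw [← card_pos, hBj x hx0]
    rcases mem_union.1 hx with hx | hx
    · exact (hjT x hx).1
    · exact hjR x hx
  · rw [← hc]
    refine sum_congr rfl fun x _ => ?_
    rcases eq_or_ne x 0 with rfl | hx
    · simp
    · rw [hBj x hx]
  · simp only [hBg, hgd]

/-- Sets `T` and `R` of indices to which `exists_parts` applies. -/
lemma exists_index_sets {p q : ℕ} [Fact p.Prime] (a : ZMod p → ℕ) (h0 : a 0 + 1 ≤ q)
    (hsum : ∑ x, a x = p + q - 1) :
    ∃ T R : Finset (ZMod p), Disjoint T R ∧ 0 ∉ T ∧ 0 ∉ R ∧ (∀ x ∈ T, 2 ≤ a x) ∧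
      (∀ x ∈ R, a x = 2) ∧ q + #T ≤ a 0 + ∑ x ∈ T, a x + (#R - 1) + 1 ∧
      p + a 0 + 2 * #T + #R ≤ ∑ x, a x + 1 ∧ ((T ∪ R).Nonempty ∨ a 0 + 1 = q) := by
  have hp := (Fact.out : p.Prime).pos
  set U : Finset (ZMod p) := univ.erase 0 with hU
  set Z := U.filter fun x => a x = 0 with hZ
  set X₁ := U.filter fun x => a x = 1 with hX₁
  set X₂ := U.filter fun x => a x = 2 with hX₂
  set X₃ := U.filter fun x => 3 ≤ a x with hX₃
  have hcard : #Z + #X₁ + #X₂ + #X₃ + 1 = p := by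
    have hUc : #U + 1 = p := by
      rw [hU, card_erase_add_one (mem_univ 0)]; simp
    have hUs : #Z + #X₁ + #X₂ + #X₃ = #U := by
      simp only [hZ, hX₁, hX₂, hX₃, card_filter, ← sum_add_distrib, card_eq_sum_ones U]
      refine sum_congr rfl fun x _ => ?_
      grind
    omega
  have htot : a 0 + #X₁ + 2 * #X₂ + ∑ x ∈ X₃, a x = p + q - 1 := by
    rw [← hsum, ← add_sum_erase univ a (mem_univ 0), ← hU]
    simp only [hX₁, hX₂, hX₃, card_filter, mul_sum, sum_filter, add_assoc, ← sum_add_distrib]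
    congr 1
    refine sum_congr rfl fun x _ => ?_
    grind
  have hX₃sum : 3 * #X₃ ≤ ∑ x ∈ X₃, a x := by
    rw [mul_comm, ← smul_eq_mul]
    exact card_nsmul_le_sum _ _ _ fun x hx => (mem_filter.1 hx).2
  have hdisj : Disjoint X₃ X₂ := by
    rw [disjoint_left]
    intro x hx hx'
    simp only [hX₂, hX₃, mem_filter] at hx hx'
    omega
  have hU3 : X₃ ⊆ U := filter_subset _ _
  have hU2 : X₂ ⊆ U := filter_subset _ _
  have h0U : (0 : ZMod p) ∉ U := by simp [hU]
  rcases le_or_gt #Z #X₂ with hle | hlt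
  · obtain ⟨R, hRX, hR⟩ := exists_subset_card_eq (show #X₂ - #Z ≤ #X₂ by omega)
    refine ⟨X₃, R, disjoint_of_subset_right hRX hdisj, fun h => h0U (hU3 h),
      fun h => h0U (hU2 (hRX h)), fun x hx => by have := (mem_filter.1 hx).2; omega,
      fun x hx => (mem_filter.1 (hRX hx)).2, by omega, by omega, ?_⟩
    left
    rw [← card_pos, card_union_of_disjoint (disjoint_of_subset_right hRX hdisj)]
    by_contra! hlt
    have : X₃ = ∅ := card_eq_zero.1 (by omega)
    rw [this] at htot hcard
    simp only [sum_empty, card_empty] at htot hcard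
    omega
  · suffices ∃ T ⊆ X₃ ∪ X₂, 2 * #T + a 0 ≤ q ∧ q + #T ≤ a 0 + ∑ x ∈ T, a x + 1 by
      obtain ⟨T, hT, hmove, hfill⟩ := this
      refine ⟨T, ∅, disjoint_empty_right _, fun h => h0U (union_subset hU3 hU2 (hT h)), by simp,
        fun x hx => ?_, by simp, by simpa using hfill, by simp; omega, ?_⟩
      · rcases mem_union.1 (hT hx) with hx | hx
        · have := (mem_filter.1 hx).2
          omega
        · exact (mem_filter.1 hx).2.ge
      · rcases T.eq_empty_or_nonempty with rfl | hne
        · right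
          simp only [card_empty, sum_empty] at hfill
          omega
        · exact Or.inl (by simpa using hne)
    set t := (q - a 0) / 2 with ht
    rcases le_or_gt t #X₃ with h3 | h3
    · obtain ⟨T, hTX, hT⟩ := exists_subset_card_eq h3
      have : 3 * #T ≤ ∑ x ∈ T, a x := by
        rw [mul_comm, ← smul_eq_mul]
        exact card_nsmul_le_sum _ _ _ fun x hx => (mem_filter.1 (hTX hx)).2
      exact ⟨T, hTX.trans subset_union_left, by omega, by omega⟩
    · obtain ⟨S, hSX, hS⟩ := exists_subset_card_eq (show min #X₂ (t - #X₃) ≤ #X₂ by omega)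
      have hd := disjoint_of_subset_right hSX hdisj
      have hSsum : ∑ x ∈ S, a x = 2 * #S := by
        rw [mul_comm, ← smul_eq_mul]
        exact sum_const_nat fun x hx => (mem_filter.1 (hSX hx)).2
      refine ⟨X₃ ∪ S, union_subset_union_right hSX, ?_, ?_⟩ <;>
        simp only [card_union_of_disjoint hd, sum_union hd, hSsum] <;> omega

/-- Any element of `ZMod p × ZMod q` is a nonempty subset sum of a set of `p + q - 1` elements. -/
lemma exists_subset_sum_eq_of_card_eq {p q : ℕ} [Fact p.Prime] [Fact q.Prime] (hq : 2 < q)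
    (A : Finset (ZMod p × ZMod q)) (hA0 : 0 ∉ A) (hA : #A = p + q - 1) (t : ZMod p × ZMod q) :
    ∃ B ⊆ A, B.Nonempty ∧ ∑ b ∈ B, b = t := by
  set F : ZMod p → Finset (ZMod q) := fun x => univ.filter fun y => (x, y) ∈ A with hF
  have hAF (x y) : (x, y) ∈ A ↔ y ∈ F x := by simp [hF]
  have hsum : ∑ x, #(F x) = p + q - 1 := by
    rw [← hA, card_eq_sum_ones A, sum_finset_product A univ F (by simp [hF])]
    simp
  have h0 : 0 ∉ F 0 := fun h => hA0 ((hAF 0 0).2 h)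
  have hF0 : #(F 0) + 1 ≤ q := by
    rw [← card_insert_of_notMem h0]
    exact (card_le_univ _).trans (ZMod.card q).le
  obtain ⟨T, R, hTR, hT0, hR0, hT, hR, hfill, hmove, hne⟩ :=
    exists_index_sets (fun x => #(F x)) hF0 hsum
  obtain ⟨B, hBF, hBne, hBc, hBd⟩ :=
    exists_parts hq F h0 T R hTR hT0 hR0 hT hR hfill hmove t.1 t.2
  set C : Finset (ZMod p × ZMod q) := univ.filter fun z => z.2 ∈ B z.1 with hC
  have hCA : C ⊆ A := fun z hz => (hAF z.1 z.2).2 (hBF _ (by simpa [hC] using hz))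
  have hCt : ∑ z ∈ C, z = t := by
    rw [sum_finset_product C univ B (by simp [hC])]
    refine Prod.ext ?_ ?_
    · simpa [Prod.fst_sum] using hBc
    · simpa [Prod.snd_sum] using hBd
  rcases C.eq_empty_or_nonempty with hCe | hCne
  · rcases hne with ⟨x, hx⟩ | hne
    · obtain ⟨y, hy⟩ := hBne x hx
      have : (x, y) ∈ C := by simpa [hC] using hy
      simp [hCe] at this
    · have hFu : insert 0 (F 0) = univ := by
        rw [← card_eq_iff_eq_univ, card_insert_of_notMem h0, ZMod.card, hne]
      have hmem (y : ZMod q) (hy : y ≠ 0) : ((0 : ZMod p), y) ∈ A := by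
        have := hFu ▸ mem_univ y
        exact (hAF 0 y).2 ((mem_insert.1 this).resolve_left hy)
      have : Fact (2 < q) := ⟨hq⟩
      refine ⟨{(0, 1), (0, -1)}, ?_, by simp, ?_⟩
      · simp [insert_subset_iff, hmem]
      · rw [sum_pair (by simpa using (ZMod.neg_one_ne_one (n := q)).symm), ← hCt, hCe]
        simp
  · exact ⟨C, hCA, hCne, hCt⟩

lemma nss_eq_univ_of_card_le {G : Type*} [AddCommGroup G] [Fintype G] [DecidableEq G] {p q : ℕ}
    [Fact p.Prime] [Fact q.Prime] (hq : 2 < q) (e : G ≃+ ZMod p × ZMod q) {A : Finset G}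
    (hA0 : 0 ∉ A) (hA : p + q - 1 ≤ #A) : nss A = univ := by
  obtain ⟨A', hA'A, hA'⟩ := exists_subset_card_eq hA
  refine eq_univ_of_forall fun t => ?_
  obtain ⟨B, hBA, hB, hBt⟩ := exists_subset_sum_eq_of_card_eq hq (A'.map e.toEquiv.toEmbedding)
    (by simpa using fun h => hA0 (hA'A h)) (by simpa using hA') (e t)
  obtain ⟨C, hC, rfl⟩ := subset_map_iff.1 hBA
  refine mem_image.2 ⟨C, mem_erase.2 ⟨?_, mem_powerset.2 (hC.trans hA'A)⟩, e.injective ?_⟩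
  · exact (map_nonempty.1 hB).ne_empty
  · simpa using hBt

lemma two_mul_abs_sum_le {m : ℕ} {K : Finset ℤ} (hK : K ⊆ Icc (-m : ℤ) m) :
    2 * |∑ k ∈ K, k| ≤ m * (m + 1) := by
  have hIcc (n : ℕ) : ∑ k ∈ Icc (-n : ℤ) n, |k| = n * (n + 1) ∧ ∑ k ∈ Icc (-n : ℤ) n, k = 0 := by
    induction n with
    | zero => simp
    | succ n ih =>
      have h : Icc (-(n + 1 : ℕ) : ℤ) (n + 1 : ℕ) =
          insert (n + 1 : ℤ) (insert (-(n + 1) : ℤ) (Icc (-n : ℤ) n)) := by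
        ext k
        simp only [mem_Icc, mem_insert]
        omega
      have h1 : (-(n + 1) : ℤ) ∉ Icc (-n : ℤ) n := by simp
      have h2 : (n + 1 : ℤ) ∉ insert (-(n + 1) : ℤ) (Icc (-n : ℤ) n) := by
        simp only [mem_Icc, mem_insert]
        omega
      rw [h, sum_insert h2, sum_insert h2, sum_insert h1, sum_insert h1, ih.1, ih.2, abs_neg,
        abs_of_nonneg (by positivity)]
      exact ⟨by push_cast; ring, by ring⟩
  have hsplit : 2 * ∑ k ∈ K, k = ∑ k ∈ Icc (-m : ℤ) m, if k ∈ K then k else -k := by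
    rw [sum_ite, filter_mem_eq_inter, inter_eq_right.2 hK, filter_notMem_eq_sdiff, sum_neg_distrib]
    linarith [sum_sdiff hK (f := fun k : ℤ => k), (hIcc m).2]
  rw [← abs_two (α := ℤ), ← abs_mul, hsplit, ← (hIcc m).1]
  refine (abs_sum_le_sum_abs _ _).trans (sum_le_sum fun k _ => ?_)
  split_ifs <;> simp

/-- The nonzero multiples `k • g` with `|k| ≤ m` miss the multiple `(m * (m + 1) / 2 + 1) • g`. -/
lemma exists_card_eq_and_nss_ne_univ {G : Type*} [AddCommGroup G] [Fintype G] [DecidableEq G]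
    (g : G) {m : ℕ} (hm : 2 * m < addOrderOf g) (hmm : m * (m + 1) + 1 < addOrderOf g) :
    ∃ A : Finset G, 0 ∉ A ∧ #A = 2 * m ∧ nss A ≠ univ := by
  have hmod {k l : ℤ} (h : k • g = l • g) (hkl : |l - k| < addOrderOf g) : k = l := by
    have := Int.eq_zero_of_abs_lt_dvd (zsmul_eq_zsmul_iff_modEq.1 h).dvd hkl
    omega
  have hinj : Set.InjOn (fun k : ℤ => k • g) (Icc (-m : ℤ) m) := by
    intro k hk l hl h
    rw [coe_Icc, Set.mem_Icc] at hk hl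
    refine hmod h ?_
    rw [abs_lt]
    omega
  refine ⟨((Icc (-m : ℤ) m).erase 0).image fun k : ℤ => k • g, ?_, ?_, fun h => ?_⟩
  · rw [mem_image]
    rintro ⟨k, hk, h⟩
    exact ne_of_mem_erase hk (hinj (mem_of_mem_erase hk) (by simp) (h.trans (zero_zsmul g).symm))
  · rw [card_image_of_injOn (hinj.mono (by simp)),
      card_erase_of_mem (by simp), Int.card_Icc]
    omega
  · have ht := h ▸ mem_univ ((m * (m + 1) / 2 + 1 : ℕ) • g)
    obtain ⟨B, hB, hBt⟩ := mem_image.1 ht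
    obtain ⟨K, hK, rfl⟩ := subset_image_iff.1 (mem_powerset.1 (mem_of_mem_erase hB))
    have hK' : K ⊆ Icc (-m : ℤ) m := hK.trans (erase_subset _ _)
    have hle := two_mul_abs_sum_le hK'
    rw [sum_image fun k hk l hl h => hinj (hK' hk) (hK' hl) h] at hBt
    simp only [id] at hBt
    rw [← sum_smul, ← natCast_zsmul] at hBt
    obtain ⟨s, hs⟩ := (Nat.even_mul_succ_self m).two_dvd
    rw [hs, Nat.mul_div_cancel_left _ two_pos] at hBt
    rw [hs] at hmm
    have hs' : (m * (m + 1) : ℤ) = 2 * s := by exact_mod_cast hs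
    rw [hs'] at hle
    have hle' : |∑ k ∈ K, k| ≤ s := by omega
    rw [abs_le] at hle'
    have := hmod hBt (by rw [abs_lt]; push_cast; omega)
    push_cast at this
    omega

lemma exists_addOrderOf_eq_mul {G : Type*} [AddCommGroup G] [Fintype G] {p q : ℕ} [Fact p.Prime]
    [Fact q.Prime] (hpq : p ≠ q) (hG : Fintype.card G = p * q) : ∃ g : G, addOrderOf g = p * q := by
  obtain ⟨x, hx⟩ := exists_prime_addOrderOf_dvd_card p (hG ▸ dvd_mul_right p q)
  obtain ⟨y, hy⟩ := exists_prime_addOrderOf_dvd_card q (hG ▸ dvd_mul_left q p)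
  have hc : (addOrderOf x).Coprime (addOrderOf y) := by
    rw [hx, hy]
    exact (Nat.coprime_primes Fact.out Fact.out).2 hpq
  exact ⟨x + y, by rw [(AddCommute.all x y).addOrderOf_add_eq_mul_addOrderOf_of_coprime hc, hx, hy]⟩

theorem cr_eq_of_card_eq_mul {G : Type*} [AddCommGroup G] [Fintype G] [DecidableEq G] {p q : ℕ}
    [Fact p.Prime] [Fact q.Prime] (hG : Fintype.card G = p * q) (hp : 2 < p) (hpq : p < q)
    (hqb : q ≤ p + Nat.sqrt (4 * (p - 2)) + 1) : cr G = q + p - 1 := by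
  obtain ⟨g, hg⟩ := exists_addOrderOf_eq_mul hpq.ne hG
  have hcyc : IsAddCyclic G :=
    isAddCyclic_of_addOrderOf_eq_card g (by rw [hg, Nat.card_eq_fintype_card, hG])
  have hcop : p.Coprime q := (Nat.coprime_primes Fact.out Fact.out).2 hpq.ne
  have hcard : Nat.card G = p * q := by rw [Nat.card_eq_fintype_card, hG]
  let e : G ≃+ ZMod p × ZMod q := (zmodAddCyclicAddEquiv hcyc).symm.trans
    ((ZMod.ringEquivCongr hcard).toAddEquiv.trans (ZMod.chineseRemainder hcop).toAddEquiv)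
  obtain ⟨m, hm⟩ : ∃ m, p + q = 2 * m + 2 := by
    obtain ⟨a, ha⟩ := (Fact.out : p.Prime).odd_of_ne_two (by omega)
    obtain ⟨b, hb⟩ := (Fact.out : q.Prime).odd_of_ne_two (by omega)
    exact ⟨a + b, by omega⟩
  have hmm : m * (m + 1) + 1 < p * q := by
    obtain ⟨u, rfl⟩ := Nat.exists_eq_add_of_le' hp.le
    obtain ⟨s, rfl⟩ := Nat.exists_eq_add_of_le (Nat.succ_le_of_lt hpq)
    rw [Nat.add_sub_cancel] at hqb
    have hs : s ^ 2 ≤ 4 * u := (Nat.pow_le_pow_left (by omega) 2).trans (Nat.sqrt_le' _)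
    zify at hm hs ⊢
    nlinarith
  have h2m : 2 * m < p * q := by nlinarith
  obtain ⟨A, hA0, hA, hAne⟩ :=
    exists_card_eq_and_nss_ne_univ g (by rwa [hg]) (by rwa [hg])
  refine le_antisymm (Nat.sInf_le ⟨by omega, fun A hA0 hA => ?_⟩) ?_
  · exact nss_eq_univ_of_card_le (hp.trans hpq) e hA0 (by omega)
  · refine le_csInf ⟨q + p - 1, by omega, fun A hA0 hA => ?_⟩ ?_
    · exact nss_eq_univ_of_card_le (hp.trans hpq) e hA0 (by omega)
    · rintro l ⟨-, hl⟩
      by_contra! hlt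
      exact hAne (hl A hA0 (by omega))

theorem stmt18 {G : Type*} [AddCommGroup G] [Fintype G] [DecidableEq G]
    (hG : 3 ≤ Fintype.card G)
    (hqprime : (Fintype.card G / (Fintype.card G).minFac).Prime)
    (hqodd : Odd (Fintype.card G / (Fintype.card G).minFac))
    (hp2 : 2 < (Fintype.card G).minFac)
    (hpq : (Fintype.card G).minFac < Fintype.card G / (Fintype.card G).minFac)
    (hqb : Fintype.card G / (Fintype.card G).minFac ≤
      (Fintype.card G).minFac + Nat.sqrt (4 * ((Fintype.card G).minFac - 2)) + 1) :
    cr G = Fintype.card G / (Fintype.card G).minFac + (Fintype.card G).minFac - 1 := by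
  have : Fact (Fintype.card G).minFac.Prime := ⟨Nat.minFac_prime (by omega)⟩
  have : Fact (Fintype.card G / (Fintype.card G).minFac).Prime := ⟨hqprime⟩
  exact cr_eq_of_card_eq_mul (Nat.mul_div_cancel' (Nat.minFac_dvd _)).symm hp2 hpq hqb
end
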